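/- Let f and g be nonsingular quadratic forms with rational coefficients having signatures (r,s) and (p,q) respectively, such that r ≥ p, s ≥ q, and rank(f) − rank(g) = (r+s) − (p+q) ≥ 3. Then f represents g. -/

import Mathlib

namespace Paper

open Matrix

/-- Value at `x` of the quadratic form with Gram matrix `Q`. -/
def qeval {m : ℕ} {R : Type*} [CommRing R] (Q : Matrix (Fin m) (Fin m) R) (x : Fin m → R) : R :=
  x ⬝ᵥ (Q *ᵥ x)

/-- The polar bilinear form `B(x,y) = (f(x+y) - f(x) - f(y))/2` of the quadratic form
with Gram matrix `Q`. -/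
def qpolar {m : ℕ} {K : Type*} [Field K] (Q : Matrix (Fin m) (Fin m) K) (x y : Fin m → K) : K :=
  (qeval Q (x + y) - qeval Q x - qeval Q y) / 2

/-- A real quadratic form (given by its Gram matrix `Q`) has signature `(r,s)`:
`r + s = m` and it is linearly equivalent over `ℝ` to
`x_1^2 + ... + x_r^2 - x_{r+1}^2 - ... - x_m^2`. -/
def RealSignature {m : ℕ} (Q : Matrix (Fin m) (Fin m) ℝ) (r s : ℕ) : Prop :=
  r + s = m ∧ ∃ T : Matrix (Fin m) (Fin m) ℝ, T.det ≠ 0 ∧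
    ∀ x : Fin m → ℝ, qeval Q (T *ᵥ x) = ∑ i : Fin m, (if (i : ℕ) < r then (x i)^2 else -(x i)^2)

/-- A rational quadratic form has signature `(r,s)` if it does as a real quadratic form. -/
def HasSignature {m : ℕ} (Q : Matrix (Fin m) (Fin m) ℚ) (r s : ℕ) : Prop :=
  RealSignature (Q.map (Rat.cast : ℚ → ℝ)) r s

/-- The rational quadratic form `F` (in `n` variables) represents the rational quadratic
form `G` (in `k` variables): after a linear change of coordinates over `ℚ`,
`F(x_1,...,x_n) = G(x_1,...,x_k) + H(x_{k+1},...,x_n)` for some rational quadratic form `H`. -/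
def Represents {n k : ℕ} (F : Matrix (Fin n) (Fin n) ℚ) (G : Matrix (Fin k) (Fin k) ℚ) : Prop :=
  ∃ (m : ℕ) (hm : n = k + m) (H : Matrix (Fin m) (Fin m) ℚ) (T : Matrix (Fin n) (Fin n) ℚ),
    T.det ≠ 0 ∧ ∀ (x : Fin k → ℚ) (y : Fin m → ℚ),
      qeval F (T *ᵥ (Fin.append x y ∘ Fin.cast hm)) = qeval G x + qeval H y

/-- The group `O(f, A)` of matrices in `GL(m, A)` preserving the quadratic form `f`
(with Gram matrix `Q` over `K ⊇ A`): those `M` with `f(Mx) = f(x)` for all `x`. -/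
def ortho {m : ℕ} (A : Type*) [CommRing A] {K : Type*} [Field K] [Algebra A K]
    (Q : Matrix (Fin m) (Fin m) K) : Subgroup (GL (Fin m) A) where
  carrier := { M | ∀ x : Fin m → K,
      qeval Q (((M : Matrix (Fin m) (Fin m) A).map (algebraMap A K)) *ᵥ x) = qeval Q x }
  one_mem' := by
    intro x
    have h1 : ((1 : GL (Fin m) A) : Matrix (Fin m) (Fin m) A).map (algebraMap A K) = 1 := by
      simp [Matrix.map_one]
    rw [h1, Matrix.one_mulVec]
  mul_mem' := by
    intro a b ha hb x
    have h : ((a * b : GL (Fin m) A) : Matrix (Fin m) (Fin m) A).map (algebraMap A K)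
        = ((a : Matrix (Fin m) (Fin m) A).map (algebraMap A K)) *
          ((b : Matrix (Fin m) (Fin m) A).map (algebraMap A K)) := by
      rw [Units.val_mul, Matrix.map_mul]
    rw [h, ← Matrix.mulVec_mulVec, ha, hb]
  inv_mem' := by
    intro a ha x
    set M := ((a : Matrix (Fin m) (Fin m) A).map (algebraMap A K)) with hM
    set N := (((a⁻¹ : GL (Fin m) A) : Matrix (Fin m) (Fin m) A).map (algebraMap A K)) with hN
    have hMN : M * N = 1 := by
      rw [hM, hN, ← Matrix.map_mul]
      have : (a : Matrix (Fin m) (Fin m) A) * ((a⁻¹ : GL (Fin m) A) : Matrix (Fin m) (Fin m) A)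
          = 1 := a.mul_inv
      rw [this]
      simp [Matrix.map_one]
    have ha' : ∀ y : Fin m → K, qeval Q (M *ᵥ y) = qeval Q y := ha
    calc qeval Q (N *ᵥ x) = qeval Q (M *ᵥ (N *ᵥ x)) := (ha' (N *ᵥ x)).symm
      _ = qeval Q ((M * N) *ᵥ x) := by rw [Matrix.mulVec_mulVec]
      _ = qeval Q x := by rw [hMN, Matrix.one_mulVec]

/-- `O(f, ℤ)` for a rational quadratic form `f` with Gram matrix `Q`. -/
abbrev OZ {m : ℕ} (Q : Matrix (Fin m) (Fin m) ℚ) : Subgroup (GL (Fin m) ℤ) := ortho ℤ Q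

/-- A group is finitely presented: it is a quotient of a finitely generated free group by
the normal closure of a finite set of relators. -/
def IsFinitelyPresented (G : Type*) [Group G] : Prop :=
  ∃ (n : ℕ) (rels : Set (FreeGroup (Fin n))), rels.Finite ∧ Nonempty (PresentedGroup rels ≃* G)

/-- A group is coherent if each of its finitely generated subgroups is finitely presented. -/
def IsCoherent (G : Type*) [Group G] : Prop :=
  ∀ H : Subgroup G, Group.FG H → IsFinitelyPresented H

/-- Two groups are abstractly commensurable if they contain isomorphic
subgroups of finite index. -/
def AbstractlyCommensurable (G H : Type*) [Group G] [Group H] : Prop :=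
  ∃ (G' : Subgroup G) (H' : Subgroup H), G'.FiniteIndex ∧ H'.FiniteIndex ∧ Nonempty (G' ≃* H')

/-- The form `q₃ = -x₀² + x₁² + x₂² + x₃²`. -/
def q3 : Matrix (Fin 4) (Fin 4) ℚ := Matrix.diagonal ![-1, 1, 1, 1]

end Paper


namespace Paper

def Hil (K : Type*) [Field K] (a b : K) : Prop :=
  ∃ x y z : K, (x ≠ 0 ∨ y ≠ 0 ∨ z ≠ 0) ∧ z ^ 2 = a * x ^ 2 + b * y ^ 2

theorem Hil.symm {K : Type*} [Field K] {a b : K} (h : Hil K a b) : Hil K b a := by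
  obtain ⟨x, y, z, h, e⟩ := h
  exact ⟨y, x, z, by tauto, by rw [e]; ring⟩

theorem Hil.of_sq {K : Type*} [Field K] {a b d : K} (hd : d ≠ 0) (h : Hil K (a * d ^ 2) b) :
    Hil K a b := by
  obtain ⟨x, y, z, h, e⟩ := h
  refine ⟨d * x, y, z, by simpa [hd] using h, by rw [e]; ring⟩

theorem Hil.mul_sq {K : Type*} [Field K] {a b d : K} (hd : d ≠ 0) (h : Hil K a b) :
    Hil K (a * d ^ 2) b := by
  obtain ⟨x, y, z, h, e⟩ := h
  refine ⟨x / d, y, z, by simpa [hd] using h, by rw [e]; field_simp⟩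

theorem Hil.step {K : Type*} [Field K] {a b b' t : K} (hb : b ≠ 0) (hb' : b' ≠ 0)
    (ht : b * b' = t ^ 2 - a) (h : Hil K a b) : Hil K a b' := by
  obtain ⟨x, y, z, h, e⟩ := h
  by_cases hy : y = 0
  · exact ⟨x, y, z, h, by rw [e, hy]; ring⟩
  · refine ⟨z + x * t, b * y, z * t + a * x, Or.inr (Or.inl (mul_ne_zero hb hy)), ?_⟩
    have : (z ^ 2 - a * x ^ 2) * (t ^ 2 - a) = b ^ 2 * b' * y ^ 2 := by
      rw [← ht, e]; ring
    linear_combination this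

/-- scaling to a primitive vector -/
theorem exists_prim {p : ℕ} [Fact p.Prime] (x y z : ℚ_[p]) (h : x ≠ 0 ∨ y ≠ 0 ∨ z ≠ 0) :
    ∃ c : ℚ_[p], c ≠ 0 ∧ ‖c * x‖ ≤ 1 ∧ ‖c * y‖ ≤ 1 ∧ ‖c * z‖ ≤ 1 ∧
      (‖c * x‖ = 1 ∨ ‖c * y‖ = 1 ∨ ‖c * z‖ = 1) := by
  have key : ∃ w : ℚ_[p], w ≠ 0 ∧ ‖x‖ ≤ ‖w‖ ∧ ‖y‖ ≤ ‖w‖ ∧ ‖z‖ ≤ ‖w‖ ∧ (w = x ∨ w = y ∨ w = z) := by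
    have h' : 0 < ‖x‖ ∨ 0 < ‖y‖ ∨ 0 < ‖z‖ := by simpa using h
    have hw : ∃ w : ℚ_[p], ‖x‖ ≤ ‖w‖ ∧ ‖y‖ ≤ ‖w‖ ∧ ‖z‖ ≤ ‖w‖ ∧ (w = x ∨ w = y ∨ w = z) := by
      rcases le_total ‖x‖ ‖y‖ with h1 | h1 <;> rcases le_total ‖y‖ ‖z‖ with h2 | h2 <;>
      rcases le_total ‖x‖ ‖z‖ with h3 | h3
      · exact ⟨z, by simp [*]⟩
      · exact ⟨z, by grind⟩
      · exact ⟨y, by grind⟩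
      · exact ⟨y, by grind⟩
      · exact ⟨z, by grind⟩
      · exact ⟨x, by grind⟩
      · exact ⟨x, by grind⟩
      · exact ⟨x, by grind⟩
    obtain ⟨w, hw⟩ := hw
    refine ⟨w, ?_, hw⟩
    rintro rfl
    simp only [norm_zero] at hw
    grind
  obtain ⟨w, hw, h1, h2, h3, h4⟩ := key
  have hp : 0 < ‖w‖ := norm_pos_iff.2 hw
  refine ⟨w⁻¹, inv_ne_zero hw, ?_, ?_, ?_, ?_⟩
  · rw [norm_mul, norm_inv, inv_mul_le_iff₀ hp]; simpa
  · rw [norm_mul, norm_inv, inv_mul_le_iff₀ hp]; simpa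
  · rw [norm_mul, norm_inv, inv_mul_le_iff₀ hp]; simpa
  · rcases h4 with rfl | rfl | rfl
    · left; simp [hw]
    · right; left; simp [hw]
    · right; right; simp [hw]

theorem norm_lt_one_le {p : ℕ} [hp : Fact p.Prime] {x : ℚ_[p]} (h : ‖x‖ < 1) :
    ‖x‖ ≤ (p : ℝ)⁻¹ := by
  have := (Padic.norm_le_pow_iff_norm_lt_pow_add_one x (-1)).2 (by simpa using h)
  simpa using this

theorem norm_int_dvd {p : ℕ} [hp : Fact p.Prime] {x : ℤ} (h : ‖(x : ℚ_[p])‖ < 1) :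
    (p : ℤ) ∣ x := by
  exact Padic.norm_intCast_lt_one_iff.1 h

theorem exists_int_near {p : ℕ} [hp : Fact p.Prime] (x : ℚ_[p]) (hx : ‖x‖ ≤ 1) (k : ℕ) :
    ∃ n : ℕ, ‖x - (n : ℚ_[p])‖ ≤ (p : ℝ) ^ (-k : ℤ) := by
  let y : ℤ_[p] := ⟨x, hx⟩
  refine ⟨PadicInt.appr y k, ?_⟩
  have := PadicInt.appr_spec k y
  rw [← PadicInt.norm_le_pow_iff_mem_span_pow] at this
  rw [PadicInt.norm_def] at this
  push_cast at this
  exact this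

theorem Hil.mod_prime {p : ℕ} [hp : Fact p.Prime] {a b : ℤ} (hb : (p : ℤ) ∣ b)
    (hb2 : ¬ (p : ℤ) ^ 2 ∣ b) (h : Hil ℚ_[p] a b) : ∃ t : ℤ, (p : ℤ) ∣ t ^ 2 - a := by
  obtain ⟨x, y, z, h, e⟩ := h
  obtain ⟨c, hc, h1, h2, h3, h4⟩ := exists_prim x y z h
  have e' : (c * z) ^ 2 = a * (c * x) ^ 2 + b * (c * y) ^ 2 := by linear_combination c ^ 2 * e
  generalize c * x = x at *
  generalize c * y = y at *
  generalize c * z = z at *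
  have hp1 : (1 : ℝ) < p := by exact_mod_cast hp.out.one_lt
  have na : ‖(a : ℚ_[p])‖ ≤ 1 := Padic.norm_int_le_one a
  have nb : ‖(b : ℚ_[p])‖ < 1 := Padic.norm_intCast_lt_one_iff.2 hb
  have nb' : (p : ℝ)⁻¹ ≤ ‖(b : ℚ_[p])‖ := by
    by_contra hlt
    push Not at hlt
    apply hb2
    have := (Padic.norm_int_le_pow_iff_dvd (p := p) b 2).1 ?_
    · exact_mod_cast this
    · have := (Padic.norm_le_pow_iff_norm_lt_pow_add_one (b : ℚ_[p]) (-2)).2 (by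
        norm_num; simpa using hlt)
      exact_mod_cast this
  have hb0 : ‖(b : ℚ_[p]) * y ^ 2‖ < 1 := by
    rw [norm_mul, norm_pow]
    calc _ ≤ ‖(b : ℚ_[p])‖ * 1 := by gcongr; exact pow_le_one₀ (norm_nonneg _) h2
      _ < 1 := by simpa
  have hx : ‖x‖ = 1 := by
    by_contra hx
    have hx : ‖x‖ < 1 := lt_of_le_of_ne h1 hx
    have hax : ‖(a : ℚ_[p]) * x ^ 2‖ < 1 := by
      rw [norm_mul, norm_pow]
      calc _ ≤ 1 * ‖x‖ ^ 2 := by gcongr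
        _ < 1 := by rw [one_mul]; exact pow_lt_one₀ (norm_nonneg _) hx (by simp)
    have hz : ‖z‖ < 1 := by
      have : ‖z ^ 2‖ < 1 := by
        rw [e']
        exact lt_of_le_of_lt (Padic.nonarchimedean _ _) (max_lt hax hb0)
      rw [norm_pow] at this
      by_contra hz
      push Not at hz
      have := one_le_pow₀ hz (n := 2)
      linarith
    have hx' := norm_lt_one_le hx
    have hz' := norm_lt_one_le hz
    have hby : ‖(b : ℚ_[p]) * y ^ 2‖ ≤ ((p : ℝ)⁻¹) ^ 2 := by
      have : (b : ℚ_[p]) * y ^ 2 = z ^ 2 + - (a * x ^ 2) := by rw [e']; ring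
      rw [this]
      refine (Padic.nonarchimedean _ _).trans (max_le ?_ ?_)
      · rw [norm_pow]; gcongr
      · rw [norm_neg, norm_mul, norm_pow]
        calc _ ≤ 1 * ‖x‖ ^ 2 := by gcongr
          _ ≤ _ := by rw [one_mul]; gcongr
    have hy : ‖y‖ ^ 2 < 1 := by
      rw [norm_mul, norm_pow] at hby
      have hp0 : (0 : ℝ) < (p : ℝ)⁻¹ := by positivity
      have : (p : ℝ)⁻¹ * ‖y‖ ^ 2 ≤ (p : ℝ)⁻¹ ^ 2 := le_trans (by gcongr) hby
      have h5 : ‖y‖ ^ 2 ≤ (p : ℝ)⁻¹ := by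
        rw [sq (p : ℝ)⁻¹] at this
        exact le_of_mul_le_mul_left this hp0
      exact lt_of_le_of_lt h5 (inv_lt_one_of_one_lt₀ hp1)
    have hy : ‖y‖ ≠ 1 := by
      intro h; rw [h] at hy; norm_num at hy
    rcases h4 with h4 | h4 | h4
    · linarith
    · exact hy h4
    · linarith
  have hx0 : x ≠ 0 := by rintro rfl; simp at hx
  obtain ⟨n, hn⟩ := exists_int_near (z / x) (by rw [norm_div, hx, div_one]; exact h3) 1
  refine ⟨n, norm_int_dvd ?_⟩
  have hn' : ‖z / x - n‖ < 1 := by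
    refine lt_of_le_of_lt hn ?_
    simpa using (inv_lt_one_of_one_lt₀ hp1)
  have e2 : (z / x) ^ 2 - a = b * (y / x) ^ 2 := by field_simp; rw [e']; ring
  have : (((n : ℤ) ^ 2 - a : ℤ) : ℚ_[p]) = b * (y / x) ^ 2 + -((z / x - n) * (z / x + n)) := by
    rw [← e2]; push_cast; ring
  rw [this]
  refine lt_of_le_of_lt (Padic.nonarchimedean _ _) (max_lt ?_ ?_)
  · rw [norm_mul, norm_pow, norm_div, hx, div_one, ← norm_pow, ← norm_mul]; exact hb0
  · rw [norm_neg, norm_mul]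
    have : ‖z / x + n‖ ≤ 1 := by
      refine (Padic.nonarchimedean _ _).trans (max_le ?_ ?_)
      · rw [norm_div, hx, div_one]; exact h3
      · exact_mod_cast Padic.norm_int_le_one (n : ℤ)
    calc _ ≤ ‖z / x - n‖ * 1 := by gcongr
      _ < 1 := by simpa

theorem square_mod_squarefree (a : ℤ) (n : ℕ) (hn : Squarefree n)
    (h : ∀ p : ℕ, p.Prime → p ∣ n → ∃ t : ℤ, (p : ℤ) ∣ t ^ 2 - a) :
    ∃ t : ℤ, (n : ℤ) ∣ t ^ 2 - a := by
  induction n using induction_on_primes with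
  | zero => simp at hn
  | one => exact ⟨0, by simp⟩
  | prime_mul p n hp ih =>
    have hc : Nat.Coprime p n := by
      exact (Nat.squarefree_mul_iff.1 hn).1
    obtain ⟨t, ht⟩ := ih (Squarefree.of_mul_right hn) (fun q hq hqn => h q hq (hqn.mul_left p))
    obtain ⟨s, hs⟩ := h p hp (Dvd.intro _ rfl)
    have hc' : IsCoprime (p : ℤ) (n : ℤ) := Nat.isCoprime_iff_coprime.2 hc
    obtain ⟨u, v, huv⟩ := hc'
    refine ⟨s * (v * n) + t * (u * p), ?_⟩
    push_cast
    refine IsCoprime.mul_dvd ⟨u, v, huv⟩ ?_ ?_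
    · have : (s * (v * n) + t * (u * p)) ^ 2 - a = (s ^ 2 - a) + p * (u * (t - s) * (2 * s + p * u * (t-s))) := by
        have : v * n = 1 - u * p := by linarith
        rw [this]; ring
      rw [this]
      exact dvd_add hs (Dvd.intro _ rfl)
    · have : (s * (v * n) + t * (u * p)) ^ 2 - a = (t ^ 2 - a) + n * (v * (s - t) * (2 * t + n * v * (s - t))) := by
        have : u * p = 1 - v * n := by linarith
        rw [this]; ring
      rw [this]
      exact dvd_add ht (Dvd.intro _ rfl)

def HilLoc (a b : ℤ) : Prop := ∀ (p : ℕ) [Fact p.Prime], p ≠ 2 → Hil ℚ_[p] a b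

theorem hil_global (N : ℕ) : ∀ a b : ℤ, a.natAbs + b.natAbs ≤ N → a ≠ 0 → b ≠ 0 → (0 < a ∨ 0 < b) →
    HilLoc a b → Hil ℚ a b := by
  induction N with
  | zero =>
    intro a b h ha hb
    exact absurd (Int.natAbs_eq_zero.1 (by omega)) ha
  | succ N ih =>
    intro a b
    wlog hab : a.natAbs ≤ b.natAbs generalizing a b with H
    · intro h ha hb hr hl
      exact (H b a (by omega) (by omega) hb ha hr.symm (fun p hp h2 => (hl p h2).symm)).symm
    intro h ha hb hr hl
    -- non squarefree cases
    have nsq : ∀ a b : ℤ, a.natAbs + b.natAbs ≤ N + 1 → a ≠ 0 → b ≠ 0 → (0 < a ∨ 0 < b) →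
        HilLoc a b → ¬ Squarefree a → Hil ℚ a b := by
      intro a b h ha hb hr hl hs
      rw [Squarefree] at hs
      push Not at hs
      obtain ⟨d, ⟨a', rfl⟩, hd⟩ := hs
      have hd0 : d ≠ 0 := by rintro rfl; simp at ha
      have ha' : a' ≠ 0 := by rintro rfl; simp at ha
      have hd2 : 2 ≤ d.natAbs := by
        rw [Int.isUnit_iff_natAbs_eq] at hd
        have := Int.natAbs_ne_zero.2 hd0
        omega
      have hlt : a'.natAbs < (d * d * a').natAbs := by
        rw [Int.natAbs_mul, Int.natAbs_mul]
        have := Int.natAbs_pos.2 ha'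
        have h4 : 4 ≤ d.natAbs * d.natAbs := Nat.mul_le_mul hd2 hd2
        have := Nat.mul_le_mul_right a'.natAbs h4
        omega
      have := ih a' b (by omega) ha' hb ?_ ?_
      · have := this.mul_sq (d := (d : ℚ)) (by exact_mod_cast hd0)
        convert this using 1; push_cast; ring
      · refine hr.imp ?_ id
        intro h
        exact pos_of_mul_pos_right h (mul_self_nonneg d)
      · intro p hp h2
        have hd0' : (d : ℚ_[p]) ≠ 0 := by exact_mod_cast hd0
        refine Hil.of_sq (d := (d : ℚ_[p])) hd0' ?_
        convert hl p h2 using 1; push_cast; ring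
    by_cases hsb : Squarefree b
    swap
    · exact (nsq b a (by omega) hb ha hr.symm (fun p hp h2 => (hl p h2).symm) hsb).symm
    by_cases hb1 : b.natAbs = 1
    · have ha1 : a.natAbs = 1 := by
        have := Int.natAbs_ne_zero.2 ha
        omega
      rcases hr with hr | hr
      · have : a = 1 := by omega
        exact ⟨1, 0, 1, by simp, by simp [this]⟩
      · have : b = 1 := by omega
        exact ⟨0, 1, 1, by simp, by simp [this]⟩
    have hb2 : 2 ≤ b.natAbs := by
      have := Int.natAbs_ne_zero.2 hb
      omega
    obtain ⟨t, ht⟩ := square_mod_squarefree a b.natAbs (Int.squarefree_natAbs.2 hsb) (by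
      intro p hp hpb
      haveI : Fact p.Prime := ⟨hp⟩
      have hpb' : (p : ℤ) ∣ b := Int.natCast_dvd.2 hpb
      by_cases h2 : p = 2
      · subst h2
        rcases Int.even_or_odd a with h | h
        · exact ⟨0, by simpa using h.two_dvd⟩
        · refine ⟨1, ?_⟩
          obtain ⟨k, rfl⟩ := h
          exact ⟨-k, by push_cast; ring⟩
      · refine (hl p h2).mod_prime hpb' ?_
        intro hd
        rw [sq] at hd
        have := hsb _ hd
        rw [Int.isUnit_iff_natAbs_eq] at this
        have := hp.one_lt
        simp at *
        omega)
    have ht' : b ∣ t ^ 2 - a := Int.natAbs_dvd.1 ht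
    -- reduce t
    obtain ⟨t, ht, htb⟩ : ∃ t : ℤ, b ∣ t ^ 2 - a ∧ 2 * t.natAbs ≤ b.natAbs := by
      refine ⟨Int.bmod t b.natAbs, ?_, ?_⟩
      · have h1 : b ∣ Int.bmod t b.natAbs - t := by
          have := Int.bmod_emod (x := t) (m := b.natAbs)
          have h2 := (Int.ModEq.dvd (n := (b.natAbs : ℤ)) (a := t) (b := Int.bmod t b.natAbs) this.symm)
          exact Int.natAbs_dvd.1 h2
        have : Int.bmod t b.natAbs ^ 2 - a = (Int.bmod t b.natAbs - t) * (Int.bmod t b.natAbs + t) + (t ^ 2 - a) := by ring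
        rw [this]
        exact dvd_add (h1.mul_right _) ht'
      · have h1 := Int.le_bmod (x := t) (m := b.natAbs) (by omega)
        have h2 := Int.bmod_lt (x := t) (m := b.natAbs) (by omega)
        omega
    obtain ⟨b', hb'⟩ := ht
    by_cases hb0 : b' = 0
    · subst hb0
      refine ⟨1, 0, t, by simp, ?_⟩
      have : t ^ 2 = a := by linarith
      have : (t : ℚ) ^ 2 = a := by exact_mod_cast this
      rw [this]; ring
    have hlt : b'.natAbs < b.natAbs := by
      have h1 : b.natAbs * b'.natAbs ≤ t.natAbs ^ 2 + a.natAbs := by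
        rw [← Int.natAbs_mul, ← hb', ← Int.natAbs_pow]
        exact Int.natAbs_sub_le _ _
      by_contra hge
      push Not at hge
      generalize b.natAbs = B at *
      generalize b'.natAbs = B' at *
      generalize t.natAbs = T at *
      have h5 : B * B ≤ B * B' := Nat.mul_le_mul_left _ hge
      have h6 : (2 * T) * (2 * T) ≤ B * B := Nat.mul_le_mul htb htb
      have h7 : 2 * B ≤ B * B := Nat.mul_le_mul_right B hb2
      nlinarith
    have := ih a b' (by omega) ha hb0 ?_ ?_
    · refine Hil.step (b := (b' : ℚ)) (b' := b) (t := t) (by exact_mod_cast hb0) (by exact_mod_cast hb) ?_ this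
      rw [mul_comm]; exact_mod_cast hb'.symm
    · by_cases h0 : 0 < a
      · exact Or.inl h0
      · right
        have hbp : 0 < b := by tauto
        have : 0 < b * b' := by rw [← hb']; nlinarith [sq_nonneg t, lt_of_le_of_ne (not_lt.1 h0) ha]
        exact pos_of_mul_pos_right this hbp.le
    · intro p hp h2
      refine Hil.step (b := (b : ℚ_[p])) (b' := b') (t := t) (by exact_mod_cast hb) (by exact_mod_cast hb0) ?_ (hl p h2)
      exact_mod_cast hb'.symm

end Paper


namespace Paper

def IsoF {K : Type*} [Field K] {ι : Type*} [Fintype ι] (d : ι → K) : Prop :=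
  ∃ v : ι → K, v ≠ 0 ∧ ∑ i, d i * v i ^ 2 = 0

theorem IsoF.of_inj {K : Type*} [Field K] {ι κ : Type*} [Fintype ι] [Fintype κ]
    {d : ι → K} (e : κ → ι) (he : Function.Injective e) (h : IsoF (fun k => d (e k))) : IsoF d := by
  classical
  obtain ⟨v, hv, h⟩ := h
  refine ⟨Function.extend e v 0, ?_, ?_⟩
  · intro h0
    apply hv
    funext k
    have := congrFun h0 (e k)
    rwa [he.extend_apply] at this
  · rw [← h]
    symm
    apply Fintype.sum_of_injective e he
    · intro i hi
      rw [Function.extend_apply' _ _ _ (by simpa using hi)]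
      simp
    · intro k
      rw [he.extend_apply]

theorem IsoF.scale {K : Type*} [Field K] {ι : Type*} [Fintype ι] {d d' : ι → K} (c : K)
    (s : ι → K) (hs : ∀ i, s i ≠ 0) (hd : ∀ i, d i * s i ^ 2 = c * d' i) (h : IsoF d') : IsoF d := by
  obtain ⟨v, hv, h⟩ := h
  refine ⟨fun i => s i * v i, ?_, ?_⟩
  · intro h0
    apply hv
    funext k
    have := congrFun h0 k
    simpa [hs k] using this
  · have : ∑ i, d i * (s i * v i) ^ 2 = c * ∑ i, d' i * v i ^ 2 := by
      rw [Finset.mul_sum]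
      refine Finset.sum_congr rfl (fun i _ => ?_)
      linear_combination v i ^ 2 * hd i
    rw [this, h, mul_zero]

theorem IsoF.represents {K : Type*} [Field K] [CharZero K] {ι : Type*} [Fintype ι] {d : ι → K}
    (hd : ∀ i, d i ≠ 0) (h : IsoF d) (e : K) : ∃ v : ι → K, ∑ i, d i * v i ^ 2 = e := by
  classical
  obtain ⟨v, hv, h⟩ := h
  obtain ⟨i, hi⟩ := Function.ne_iff.1 hv
  simp only [Pi.zero_apply] at hi
  refine ⟨fun j => ((e - d i) / (2 * d i * v i)) * v j + if j = i then 1 else 0, ?_⟩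
  set α := (e - d i) / (2 * d i * v i)
  have : ∀ j, d j * (α * v j + if j = i then 1 else 0) ^ 2 =
      α ^ 2 * (d j * v j ^ 2) + if j = i then (2 * α * d i * v i + d i) else 0 := by
    intro j
    split_ifs with hj
    · subst hj; ring
    · ring
  simp_rw [this]
  rw [Finset.sum_add_distrib, ← Finset.mul_sum, h]
  simp only [mul_zero, Finset.sum_ite_eq', Finset.mem_univ, if_true, zero_add]
  have := hd i
  simp only [α]
  field_simp
  ring

theorem sq_of_near_one {p : ℕ} [hp : Fact p.Prime] {x : ℚ_[p]} (h : ‖x - 1‖ < ‖(4 : ℚ_[p])‖) :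
    ∃ s : ℚ_[p], s ≠ 0 ∧ x = s ^ 2 := by
  have h4 : ‖(4 : ℚ_[p])‖ ≤ 1 := by exact_mod_cast Padic.norm_int_le_one (p := p) 4
  have hx : ‖x‖ ≤ 1 := by
    have : x = (x - 1) + 1 := by ring
    rw [this]
    exact (Padic.nonarchimedean _ _).trans (max_le (h.le.trans h4) (by simp))
  let X : ℤ_[p] := ⟨x, hx⟩
  let F : Polynomial ℤ_[p] := Polynomial.X ^ 2 - Polynomial.C X
  have hF : ‖F.aeval (1 : ℤ_[p])‖ < ‖F.derivative.aeval (1 : ℤ_[p])‖ ^ 2 := by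
    have e1 : F.aeval (1 : ℤ_[p]) = 1 - X := by simp [F]
    have e2 : F.derivative.aeval (1 : ℤ_[p]) = 2 := by simp [F]; norm_num
    rw [e1, e2, ← norm_pow, PadicInt.norm_def, PadicInt.norm_def]
    push_cast
    rw [← norm_neg]
    have e3 : -((1 : ℚ_[p]) - (X : ℚ_[p])) = x - 1 := by
      change -((1 : ℚ_[p]) - x) = x - 1
      ring
    have e4 : (((2 : ℤ_[p]) : ℚ_[p])) ^ 2 = 4 := by
      change ((2 : ℚ_[p])) ^ 2 = 4
      norm_num
    rw [e3, e4]
    exact h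
  obtain ⟨z, hz, -⟩ := hensels_lemma hF
  have hz' : z ^ 2 = X := by
    have : z ^ 2 - X = 0 := by simpa [F] using hz
    exact sub_eq_zero.1 this
  have hx2 : x = (z : ℚ_[p]) ^ 2 := by
    have := congrArg (fun t : ℤ_[p] => (t : ℚ_[p])) hz'
    simpa [X] using this.symm
  refine ⟨z, ?_, hx2⟩
  intro h0
  rw [hx2, h0] at h
  norm_num at h
  linarith

theorem sq_of_near {p : ℕ} [hp : Fact p.Prime] {u u' : ℚ_[p]} (h : ‖u' - u‖ < ‖(4 : ℚ_[p])‖ * ‖u‖) :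
    ∃ s : ℚ_[p], s ≠ 0 ∧ u' = u * s ^ 2 := by
  have hu : u ≠ 0 := by
    rintro rfl
    simp at h
    have := norm_nonneg u'
    linarith
  obtain ⟨s, hs, e⟩ := sq_of_near_one (x := u' / u) (by
    have : u' / u - 1 = (u' - u) / u := by field_simp
    rw [this, norm_div, div_lt_iff₀ (norm_pos_iff.2 hu)]
    exact h)
  exact ⟨s, hs, by rw [← e]; field_simp⟩

theorem IsoF.solver {p : ℕ} [hp : Fact p.Prime] {ι : Type*} [Fintype ι] {d : ι → ℚ_[p]}
    (i : ι) (v : ι → ℚ_[p]) (hv : v i = 1)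
    (h : ‖∑ j, d j * v j ^ 2‖ < ‖(4 : ℚ_[p])‖ * ‖d i‖) : IsoF d := by
  classical
  have hd : d i ≠ 0 := by
    intro h0
    rw [h0] at h; simp at h
    have := norm_nonneg (∑ j, d j * v j ^ 2)
    linarith
  set N := ∑ j, d j * v j ^ 2 with hN
  obtain ⟨s, hs, e⟩ := sq_of_near (u := d i) (u' := d i - N) (by simpa using h)
  refine ⟨Function.update v i s, ?_, ?_⟩
  · intro h0
    have := congrFun h0 i
    simp [hs] at this
  · rw [← Finset.add_sum_erase _ _ (Finset.mem_univ i)] at hN ⊢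
    rw [Function.update_self, ← e]
    have : ∑ x ∈ Finset.univ.erase i, d x * Function.update v i s x ^ 2 =
        ∑ x ∈ Finset.univ.erase i, d x * v x ^ 2 := by
      refine Finset.sum_congr rfl (fun j hj => ?_)
      rw [Function.update_of_ne (Finset.ne_of_mem_erase hj)]
    rw [this, hN, hv]
    ring

theorem norm_unit {p : ℕ} [hp : Fact p.Prime] {a : ℤ} (h : ¬ (p : ℤ) ∣ a) : ‖(a : ℚ_[p])‖ = 1 := by
  refine le_antisymm (Padic.norm_int_le_one a) (not_lt.1 ?_)
  rwa [Padic.norm_intCast_lt_one_iff]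

theorem norm_four {p : ℕ} [hp : Fact p.Prime] (h2 : p ≠ 2) : ‖(4 : ℚ_[p])‖ = 1 := by
  have := norm_unit (p := p) (a := 4) (by
    intro h
    have h : p ∣ 4 := by exact_mod_cast h
    have : p ∣ 2 ^ 2 := by simpa using h
    have := (Nat.prime_dvd_prime_iff_eq hp.out Nat.prime_two).1 (hp.out.dvd_of_dvd_pow this)
    exact h2 this)
  exact_mod_cast this

theorem iso3_units {p : ℕ} [hp : Fact p.Prime] (h2 : p ≠ 2) (a b c : ℤ) (ha : ¬ (p : ℤ) ∣ a)
    (hb : ¬ (p : ℤ) ∣ b) (hc : ¬ (p : ℤ) ∣ c) : IsoF (K := ℚ_[p]) ![(a : ℚ_[p]), b, c] := by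
  have ha' : (a : ZMod p) ≠ 0 := by rwa [Ne, ZMod.intCast_zmod_eq_zero_iff_dvd]
  have hb' : (b : ZMod p) ≠ 0 := by rwa [Ne, ZMod.intCast_zmod_eq_zero_iff_dvd]
  obtain ⟨x, y, hxy⟩ := FiniteField.exists_root_sum_quadratic (R := ZMod p)
    (f := Polynomial.C (a : ZMod p) * Polynomial.X ^ 2 + Polynomial.C 0 * Polynomial.X + Polynomial.C (c : ZMod p))
    (g := Polynomial.C (b : ZMod p) * Polynomial.X ^ 2 + Polynomial.C 0 * Polynomial.X + Polynomial.C 0)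
    (Polynomial.degree_quadratic ha') (Polynomial.degree_quadratic hb')
    (by rw [ZMod.card]; exact (hp.out.eq_two_or_odd.resolve_left h2))
  simp at hxy
  obtain ⟨X, rfl⟩ := ZMod.intCast_surjective x
  obtain ⟨Y, rfl⟩ := ZMod.intCast_surjective y
  have hd : (p : ℤ) ∣ a * X ^ 2 + c + b * Y ^ 2 := by
    rw [← ZMod.intCast_zmod_eq_zero_iff_dvd]
    push_cast; exact hxy
  refine IsoF.solver 2 ![(X : ℚ_[p]), Y, 1] (by simp) ?_
  rw [norm_four h2]
  simp [Fin.sum_univ_three]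
  rw [norm_unit hc]
  have := Padic.norm_intCast_lt_one_iff.2 hd
  push_cast at this
  convert this using 2
  ring

theorem norm_eight {N : ℤ} (h : 8 ∣ N) : ‖(N : ℚ_[2])‖ < ‖(4 : ℚ_[2])‖ := by
  have h4 : ‖(4 : ℚ_[2])‖ = 1 / 4 := by
    have : (4 : ℚ_[2]) = (2 : ℕ) ^ 2 := by norm_num
    rw [this, norm_pow, Padic.norm_p]; norm_num
  have := (Padic.norm_int_le_pow_iff_dvd (p := 2) N 3).2 (by simpa using h)
  rw [h4]
  refine lt_of_le_of_lt this ?_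
  norm_num

theorem iso4_two (a b c d : ℤ) (ha : ¬ (2 : ℤ) ∣ a) (hb : ¬ (2 : ℤ) ∣ b) (hc : ¬ (2 : ℤ) ∣ c)
    (hd : ¬ (2 : ℤ) ∣ d) : IsoF (K := ℚ_[2]) ![(a : ℚ_[2]), b, c, 2 * d] := by
  have key : ∃ z w : ℤ, 8 ∣ a + b + c * (2 * z) ^ 2 + 2 * d * w ^ 2 := by
    by_cases h : 4 ∣ a + b
    · by_cases h' : 8 ∣ a + b
      · exact ⟨0, 0, by simpa⟩
      · exact ⟨1, 0, by norm_num; omega⟩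
    · by_cases h' : 8 ∣ a + b + 2 * d
      · exact ⟨0, 1, by simpa⟩
      · exact ⟨1, 1, by norm_num; omega⟩
  obtain ⟨z, w, h⟩ := key
  refine IsoF.solver 0 ![1, 1, 2 * (z : ℚ_[2]), w] (by simp) ?_
  have := norm_eight h
  simp only [Matrix.cons_val_zero]
  rw [norm_unit (p := 2) (by exact_mod_cast ha), mul_one]
  convert this using 2
  simp [Fin.sum_univ_four]

theorem iso5_two (a b c d e : ℤ) (ha : ¬ (2 : ℤ) ∣ a) (hb : ¬ (2 : ℤ) ∣ b) (hc : ¬ (2 : ℤ) ∣ c)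
    (hd : ¬ (2 : ℤ) ∣ d) (he : ¬ (2 : ℤ) ∣ e) : IsoF (K := ℚ_[2]) ![(a : ℚ_[2]), b, c, d, e] := by
  have key : ∃ y z w t : ℤ, 8 ∣ a + b * y ^ 2 + c * z ^ 2 + d * w ^ 2 + e * t ^ 2 := by
    by_cases h : 4 ∣ a + b
    · by_cases h' : 8 ∣ a + b
      · exact ⟨1, 0, 0, 0, by simpa⟩
      · exact ⟨1, 2, 0, 0, by norm_num; omega⟩
    by_cases h1 : 4 ∣ a + c
    · by_cases h' : 8 ∣ a + c
      · exact ⟨0, 1, 0, 0, by simpa⟩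
      · exact ⟨2, 1, 0, 0, by norm_num; omega⟩
    by_cases h2 : 4 ∣ a + d
    · by_cases h' : 8 ∣ a + d
      · exact ⟨0, 0, 1, 0, by simpa⟩
      · exact ⟨2, 0, 1, 0, by norm_num; omega⟩
    by_cases h' : 8 ∣ a + b + c + d
    · exact ⟨1, 1, 1, 0, by simpa⟩
    · exact ⟨1, 1, 1, 2, by norm_num; omega⟩
  obtain ⟨y, z, w, t, h⟩ := key
  refine IsoF.solver 0 ![1, y, (z : ℚ_[2]), w, t] (by simp) ?_
  have := norm_eight h
  simp only [Matrix.cons_val_zero]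
  rw [norm_unit (p := 2) (by exact_mod_cast ha), mul_one]
  convert this using 2
  simp [Fin.sum_univ_five]

theorem exists_unit_part (p : ℕ) [hp : Fact p.Prime] (a : ℤ) (ha : a ≠ 0) :
    ∃ (k : ℕ) (e : Bool) (u : ℤ), ¬ (p : ℤ) ∣ u ∧ a = p ^ (2 * k) * ((if e then p else 1) * u) := by
  have hp1 : ¬ IsUnit (p : ℤ) := by
    rw [Int.isUnit_iff_natAbs_eq]; simpa using hp.out.ne_one
  obtain ⟨n, u, hu, h⟩ := (FiniteMultiplicity.exists_eq_pow_mul_and_not_dvd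
    (a := (p : ℤ)) (b := a) (Int.finiteMultiplicity_iff.2 ⟨by simpa using hp.out.ne_one, ha⟩)) |> fun ⟨c, hc, h⟩ => (⟨_, c, h, hc⟩ : ∃ n u, ¬ (p : ℤ) ∣ u ∧ a = p ^ n * u)
  rcases Nat.even_or_odd' n with ⟨k, rfl | rfl⟩
  · exact ⟨k, false, u, hu, by simpa using h⟩
  · exact ⟨k, true, u, hu, by rw [h]; simp; ring⟩

theorem iso5_local (p : ℕ) [hp : Fact p.Prime] (a : Fin 5 → ℤ) (ha : ∀ i, a i ≠ 0) :
    IsoF (fun i => (a i : ℚ_[p])) := by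
  choose k e u hu h using fun i => exists_unit_part p (a i) (ha i)
  have hp0 : (p : ℚ_[p]) ≠ 0 := by exact_mod_cast hp.out.ne_zero
  suffices H : IsoF (fun i => (((if e i then (p : ℚ_[p]) else 1) * u i))) by
    refine H.scale 1 (fun i => ((p : ℚ_[p]) ^ k i)⁻¹) (fun i => by positivity) ?_
    intro i
    rw [h i]
    push_cast
    have : (p : ℚ_[p]) ^ k i ≠ 0 := pow_ne_zero _ hp0
    rw [pow_mul']
    split_ifs <;> field_simp <;> simp
  clear h
  have comb : ∀ e : Fin 5 → Bool, ∃ i j k l m : Fin 5, Function.Injective ![i, j, k, l, m] ∧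
      e i = e j ∧ e i = e k ∧ (e i ≠ e l ∨ (e i = e l ∧ e i = e m)) := by decide +revert
  obtain ⟨i, j, k, l, m, hinj, h1, h2, h3⟩ := comb e
  by_cases hp2 : p = 2
  · subst hp2
    rcases h3 with h3 | ⟨h3, h4⟩
    · have hinj4 : Function.Injective ![i, j, k, l] := by
        intro x y hxy
        have := @hinj (Fin.castSucc x) (Fin.castSucc y) (by fin_cases x <;> fin_cases y <;> simpa using hxy)
        simpa using this
      refine IsoF.of_inj ![i, j, k, l] hinj4 ?_
      have := iso4_two (u i) (u j) (u k) (u l) (by exact_mod_cast hu i) (by exact_mod_cast hu j)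
        (by exact_mod_cast hu k) (by exact_mod_cast hu l)
      rcases hb : e i
      · refine this.scale 1 (fun _ => 1) (by simp) ?_
        intro x
        have hl : e l = true := by revert h3; rw [hb]; cases e l <;> simp
        fin_cases x <;> simp [hb, ← h1, ← h2, hl]
      · refine this.scale 2 ![1, 1, 1, 2] (by intro x; fin_cases x <;> simp) ?_
        intro x
        have hl : e l = false := by revert h3; rw [hb]; cases e l <;> simp
        fin_cases x <;> simp [hb, ← h1, ← h2, hl]
        ring
    · refine IsoF.of_inj _ hinj ?_
      have := iso5_two (u i) (u j) (u k) (u l) (u m) (by exact_mod_cast hu i) (by exact_mod_cast hu j)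
        (by exact_mod_cast hu k) (by exact_mod_cast hu l) (by exact_mod_cast hu m)
      refine this.scale (if e i then 2 else 1) (fun _ => 1) (by simp) ?_
      intro x
      rcases hb : e i <;> fin_cases x <;> simp [← h1, ← h2, ← h3, ← h4, hb]
  · have hinj4 : Function.Injective ![i, j, k] := by
      intro x y hxy
      have := @hinj (Fin.castSucc (Fin.castSucc x)) (Fin.castSucc (Fin.castSucc y)) (by fin_cases x <;> fin_cases y <;> simpa using hxy)
      simpa using this
    refine IsoF.of_inj _ hinj4 ?_
    have := iso3_units hp2 (u i) (u j) (u k) (hu i) (hu j) (hu k)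
    refine this.scale (if e i then p else 1) (fun _ => 1) (by simp) ?_
    intro x
    rcases hb : e i <;> fin_cases x <;> simp [← h1, ← h2, hb]

end Paper


namespace Paper

theorem iso_split {K : Type*} [Field K] [CharZero K] {ι : Type*} [Fintype ι] [Nonempty ι]
    {a b : K} {e : ι → K} (ha : a ≠ 0) (hb : b ≠ 0) (he : ∀ i, e i ≠ 0) (x y : K) (v : ι → K)
    (hne : x ≠ 0 ∨ y ≠ 0 ∨ v ≠ 0) (h : a * x ^ 2 + b * y ^ 2 + ∑ i, e i * v i ^ 2 = 0) :
    ∃ (x y : K) (v : ι → K), a * x ^ 2 + b * y ^ 2 ≠ 0 ∧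
      a * x ^ 2 + b * y ^ 2 + ∑ i, e i * v i ^ 2 = 0 := by
  classical
  by_cases h0 : a * x ^ 2 + b * y ^ 2 = 0
  · by_cases hv : v = 0
    · obtain ⟨i⟩ := ‹Nonempty ι›
      have hiso : IsoF ![a, b] := by
        refine ⟨![x, y], ?_, by simpa using h0⟩
        intro h'
        have h1 := congrFun h' 0
        have h2 := congrFun h' 1
        simp at h1 h2
        simp_all
      obtain ⟨w, hw⟩ := hiso.represents (by intro j; fin_cases j <;> simpa) (-e i)
      simp [Fin.sum_univ_two] at hw
      refine ⟨w 0, w 1, fun j => if j = i then 1 else 0, ?_, ?_⟩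
      · rw [hw]; exact neg_ne_zero.2 (he i)
      · rw [hw]; simp
    · have hiso : IsoF e := ⟨v, hv, by simpa [h0] using h⟩
      obtain ⟨w, hw⟩ := hiso.represents he (-a)
      exact ⟨1, 0, w, by simpa using ha, by rw [hw]; ring⟩
  · exact ⟨x, y, v, h0, h⟩

theorem exists_scale {p : ℕ} [hp : Fact p.Prime] {ι : Type*} [Fintype ι] (v : ι → ℚ_[p]) :
    ∃ N : ℕ, ∀ i, ‖(p : ℚ_[p]) ^ N * v i‖ ≤ 1 := by
  have hp1 : (1 : ℝ) < p := by exact_mod_cast hp.out.one_lt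
  obtain ⟨N, hN⟩ := pow_unbounded_of_one_lt (∑ i, ‖v i‖) hp1
  refine ⟨N, fun i => ?_⟩
  rw [norm_mul, norm_pow, Padic.norm_p, inv_pow]
  have : ‖v i‖ ≤ ∑ i, ‖v i‖ := Finset.single_le_sum (f := fun i => ‖v i‖) (fun _ _ => norm_nonneg _) (Finset.mem_univ i)
  rw [inv_mul_le_iff₀ (by positivity)]
  linarith

theorem not_pow_dvd {p : ℕ} [hp : Fact p.Prime] {t : ℤ_[p]} (ht : t ≠ 0) :
    ∃ k : ℕ, ¬ (p : ℤ_[p]) ^ k ∣ t := by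
  have hp1 : (1 : ℝ) < p := by exact_mod_cast hp.out.one_lt
  have : 0 < ‖t‖ := norm_pos_iff.2 ht
  obtain ⟨k, hk⟩ := pow_unbounded_of_one_lt (‖t‖⁻¹) hp1
  refine ⟨k, fun h => ?_⟩
  have := (PadicInt.norm_le_pow_iff_mem_span_pow t k).2 (Ideal.mem_span_singleton.2 h)
  rw [zpow_neg, zpow_natCast] at this
  have h3 : ‖t‖⁻¹ < ‖t‖⁻¹ := hk.trans_le (by rw [le_inv_comm₀] <;> first | assumption | positivity)
  exact lt_irrefl _ h3

theorem appr_dvd {p : ℕ} [hp : Fact p.Prime] (x : ℤ_[p]) (k : ℕ) : ∃ n : ℕ, (p : ℤ_[p]) ^ k ∣ x - n :=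
  ⟨x.appr k, Ideal.mem_span_singleton.1 (PadicInt.appr_spec k x)⟩

theorem quad_dvd {R : Type*} [CommRing R] {P : R} (a : R) {x y : R} (h : P ∣ x - y) :
    P ∣ a * x ^ 2 - a * y ^ 2 := by
  have : a * x ^ 2 - a * y ^ 2 = (x - y) * (a * (x + y)) := by ring
  rw [this]; exact h.mul_right _

theorem loc4 {p : ℕ} [hp : Fact p.Prime] (a b c d : ℤ) (ha : a ≠ 0) (hb : b ≠ 0) (hc : c ≠ 0)
    (hd : d ≠ 0) (h : IsoF ![(a : ℚ_[p]), b, c, d]) :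
    ∃ k : ℕ, ∀ K : ℕ, k ≤ K → ∃ X Y Z W : ℕ, (p : ℤ) ^ K ∣ a * X ^ 2 + b * Y ^ 2 + c * Z ^ 2 + d * W ^ 2 ∧
      ¬ (p : ℤ) ^ k ∣ a * X ^ 2 + b * Y ^ 2 := by
  obtain ⟨v, hv, h⟩ := h
  simp [Fin.sum_univ_four] at h
  obtain ⟨x, y, w, h1, h2⟩ := iso_split (a := (a : ℚ_[p])) (b := b) (e := ![(c : ℚ_[p]), d])
    (by exact_mod_cast ha) (by exact_mod_cast hb)
    (by intro i; fin_cases i <;> simpa) (v 0) (v 1) ![v 2, v 3] (by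
      by_contra hcon
      push Not at hcon
      obtain ⟨h0, h1, h2⟩ := hcon
      apply hv
      have h3 := congrFun h2 0
      have h4 := congrFun h2 1
      simp at h3 h4
      funext i; fin_cases i <;> simpa) (by simp [Fin.sum_univ_two]; linear_combination h)
  simp [Fin.sum_univ_two] at h2
  obtain ⟨N, hN⟩ := exists_scale ![x, y, w 0, w 1]
  have hp0 : (p : ℚ_[p]) ≠ 0 := by exact_mod_cast hp.out.ne_zero
  set P := (p : ℚ_[p]) ^ N with hP
  have hP0 : P ≠ 0 := pow_ne_zero _ hp0
  obtain ⟨x', hx'⟩ : ∃ t : ℤ_[p], (t : ℚ_[p]) = P * (x) := ⟨⟨P * (x), hN 0⟩, rfl⟩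
  obtain ⟨y', hy'⟩ : ∃ t : ℤ_[p], (t : ℚ_[p]) = P * (y) := ⟨⟨P * (y), hN 1⟩, rfl⟩
  obtain ⟨z', hz'⟩ : ∃ t : ℤ_[p], (t : ℚ_[p]) = P * (w 0) := ⟨⟨P * (w 0), hN 2⟩, rfl⟩
  obtain ⟨w', hw'⟩ : ∃ t : ℤ_[p], (t : ℚ_[p]) = P * (w 1) := ⟨⟨P * (w 1), hN 3⟩, rfl⟩
  have e1 : (a : ℤ_[p]) * x' ^ 2 + b * y' ^ 2 ≠ 0 := by
    intro h'
    have := congrArg (fun t : ℤ_[p] => (t : ℚ_[p])) h'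
    simp [hx', hy'] at this
    apply h1
    have h3 : P ^ 2 * (a * x ^ 2 + b * y ^ 2) = 0 := by linear_combination this
    simpa [hP0] using h3
  have e2 : (a : ℤ_[p]) * x' ^ 2 + b * y' ^ 2 + c * z' ^ 2 + d * w' ^ 2 = 0 := by
    apply Subtype.ext
    simp [hx', hy', hz', hw']
    linear_combination P ^ 2 * h2
  obtain ⟨k, hk⟩ := not_pow_dvd e1
  refine ⟨k, fun K hK => ?_⟩
  obtain ⟨X, hX⟩ := appr_dvd x' K
  obtain ⟨Y, hY⟩ := appr_dvd y' K
  obtain ⟨Z, hZ⟩ := appr_dvd z' K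
  obtain ⟨W, hW⟩ := appr_dvd w' K
  refine ⟨X, Y, Z, W, ?_, ?_⟩
  · have := (PadicInt.pow_p_dvd_int_iff (p := p) K (a * X ^ 2 + b * Y ^ 2 + c * Z ^ 2 + d * W ^ 2)).1
    simp only [Int.cast_add, Int.cast_mul, Int.cast_pow, Int.cast_natCast] at this
    apply this
    have h3 := dvd_add (dvd_add (quad_dvd (a : ℤ_[p]) hX) (quad_dvd (b : ℤ_[p]) hY)) (dvd_add (quad_dvd (c : ℤ_[p]) hZ) (quad_dvd (d : ℤ_[p]) hW))
    rw [← dvd_neg]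
    convert h3 using 1
    linear_combination -e2
  · intro h'
    have := (PadicInt.pow_p_dvd_int_iff (p := p) k (a * X ^ 2 + b * Y ^ 2)).2 (by exact_mod_cast h')
    simp only [Int.cast_add, Int.cast_mul, Int.cast_pow, Int.cast_natCast] at this
    apply hk
    have h3 := (pow_dvd_pow _ hK).trans (dvd_add (quad_dvd (a : ℤ_[p]) hX) (quad_dvd (b : ℤ_[p]) hY))
    have := dvd_add h3 this
    convert this using 1
    ring

theorem crt (n : ℕ) (hn : n ≠ 0) (f : ℕ → ℕ) (B : ℕ) : ∃ x : ℕ, B ≤ x ∧ ∀ p ∈ n.primeFactors,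
    ((p : ℤ) ^ (n.factorization p)) ∣ (x : ℤ) - f p := by
  obtain ⟨x, hx⟩ := Nat.chineseRemainderOfFinset f (fun p => p ^ n.factorization p) n.primeFactors
    (fun p hp => pow_ne_zero _ (Nat.prime_of_mem_primeFactors hp).ne_zero) (by
      intro p hp q hq hpq
      exact Nat.Coprime.pow _ _ ((Nat.coprime_primes (Nat.prime_of_mem_primeFactors hp) (Nat.prime_of_mem_primeFactors hq)).2 hpq))
  refine ⟨x + n * B, by nlinarith [Nat.pos_of_ne_zero hn], fun p hp => ?_⟩
  have h1 := (hx p hp).symm.dvd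
  have h2 : ((p ^ n.factorization p : ℕ) : ℤ) ∣ n * B :=
    Dvd.dvd.mul_right (by exact_mod_cast Nat.ordProj_dvd n p) _
  have := dvd_add h1 h2
  push_cast at this ⊢
  have e : (x : ℤ) + n * B - f p = x - f p + n * B := by ring
  rw [e]; exact this

theorem dvd_of_local (n : ℕ) (hn : n ≠ 0) (y : ℤ)
    (h : ∀ p ∈ n.primeFactors, ((p : ℤ) ^ (n.factorization p)) ∣ y) : (n : ℤ) ∣ y := by
  rw [Int.natCast_dvd]
  by_cases hy : y = 0
  · simp [hy]
  rw [← Nat.factorization_prime_le_iff_dvd hn (by simpa using hy)]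
  intro p hp
  by_cases hpn : p ∣ n
  · have := h p (by simp [hp, hpn, hn])
    rw [← hp.pow_dvd_iff_le_factorization (by simpa using hy)]
    rw [← Int.natCast_dvd]; exact_mod_cast this
  · rw [Nat.factorization_eq_zero_of_not_dvd hpn]; exact Nat.zero_le _

theorem jac_one (a b : ℤ) (m : ℕ) : ∀ (n : ℕ) (x y : ℤ), n ≠ 0 → (m : ℤ) * n = a * x ^ 2 + b * y ^ 2 →
    n.Coprime m → (n : ℤ).gcd (a * b) = 1 → jacobiSym (-(a * b)) n = 1 := by
  intro n
  induction n using Nat.strong_induction_on with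
  | _ n ih =>
  intro x y hn h hm hab
  by_contra hJ
  have hgcd : (-(a * b)).gcd n = 1 := by rw [Int.neg_gcd, Int.gcd_comm]; exact hab
  have hJ' : jacobiSym (-(a * b)) n = -1 := (jacobiSym.eq_one_or_neg_one hgcd).resolve_left hJ
  obtain ⟨l, hl, hln, hlJ⟩ := jacobiSym.eq_neg_one_at_prime_divisor_of_eq_neg_one hJ'
  have : Fact l.Prime := ⟨hl⟩
  have hlz : (l : ℤ) ≠ 0 := by exact_mod_cast hl.ne_zero
  have hlp : Prime (l : ℤ) := Nat.prime_iff_prime_int.1 hl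
  have hln' : (l : ℤ) ∣ n := by exact_mod_cast hln
  have hla : ¬ (l : ℤ) ∣ a * b := by
    intro h'
    have := Int.dvd_coe_gcd hln' h'
    rw [hab] at this
    exact hlp.not_isUnit (isUnit_of_dvd_one (by exact_mod_cast this))
  have hla' : ¬ (l : ℤ) ∣ a := fun h' => hla (h'.mul_right _)
  have hlm : ¬ l ∣ m := fun h' => hl.one_lt.ne' (Nat.dvd_one.1 (hm ▸ Nat.dvd_gcd hln h'))
  obtain ⟨h1, h2⟩ := jacobiSym.prime_dvd_of_eq_neg_one hlJ (x := a * x) (y := y) (by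
    have e : (a * x) ^ 2 - -(a * b) * y ^ 2 = a * (m * n) := by rw [h]; ring
    rw [e]; exact (hln'.mul_left _).mul_left _)
  obtain ⟨x', rfl⟩ := (hlp.dvd_or_dvd h1).resolve_left hla'
  obtain ⟨y', rfl⟩ := h2
  have h3 : (l : ℤ) ^ 2 ∣ m * n := ⟨a * x' ^ 2 + b * y' ^ 2, by rw [h]; ring⟩
  have h4 : l ^ 2 ∣ m * n := by exact_mod_cast h3
  have h5 : l ^ 2 ∣ n := (Nat.Coprime.pow_left 2 ((Nat.Prime.coprime_iff_not_dvd hl).2 hlm)).dvd_of_dvd_mul_left h4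
  obtain ⟨n', rfl⟩ := h5
  have hn' : n' ≠ 0 := by rintro rfl; simp at hn
  apply hJ
  rw [jacobiSym.mul_right' _ (pow_ne_zero _ hl.ne_zero) hn', jacobiSym.pow_right, hlJ]
  rw [ih n' ?_ x' y' hn' ?_ ?_ ?_]
  · norm_num
  · have : 1 < l ^ 2 := Nat.one_lt_pow (by norm_num) hl.one_lt
    nlinarith [Nat.pos_of_ne_zero hn']
  · push_cast at h
    have : (l : ℤ) ^ 2 * (m * n') = l ^ 2 * (a * x' ^ 2 + b * y' ^ 2) := by linear_combination h
    exact mul_left_cancel₀ (pow_ne_zero _ hlz) this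
  · exact Nat.Coprime.coprime_mul_left hm
  · have : IsCoprime ((l ^ 2 * n' : ℕ) : ℤ) (a * b) := Int.isCoprime_iff_gcd_eq_one.2 hab
    push_cast at this
    exact Int.isCoprime_iff_gcd_eq_one.1 this.of_mul_left_right

/-- Key step: solving the ternary form with a Dirichlet prime. -/
theorem ternary_dirichlet (a b : ℤ) (ha : 0 < a) (hb : b ≠ 0) (M m n q : ℕ) (x y : ℤ)
    (hq : q.Prime) (habM : 4 * (a * b) ∣ M) (hm0 : m ≠ 0) (hn0 : n ≠ 0)
    (h : (m : ℤ) * n = a * x ^ 2 + b * y ^ 2) (hnM : n.Coprime M) (hqn : q ≡ n [MOD M])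
    (hmM : ∀ l : ℕ, l.Prime → l ∣ m → l ∣ M) :
    ∃ X Y : ℚ, (a : ℚ) * X ^ 2 + b * Y ^ 2 = m * q := by
  have hqM : q.Coprime M := by
    have := hqn.gcd_eq
    rw [Nat.Coprime, this]; exact hnM
  have h4M : (4 : ℤ) ∣ M := (Dvd.intro _ rfl).trans habM
  have h2M : 2 ∣ M := by
    have : (4 : ℕ) ∣ M := by exact_mod_cast h4M
    omega
  have hab0 : a * b ≠ 0 := mul_ne_zero ha.ne' hb
  have habM' : (a * b) ∣ M := (Dvd.intro_left _ rfl).trans habM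
  have odd_of : ∀ n : ℕ, n.Coprime M → Odd n := by
    intro n hn
    exact Nat.coprime_two_right.1 (hn.coprime_dvd_right h2M)
  have hJn : jacobiSym (-(a * b)) n = 1 := by
    apply jac_one a b m n x y hn0 h
    · apply Nat.coprime_of_dvd
      intro l hl h1 h2
      exact hl.one_lt.ne' (Nat.dvd_one.1 (hnM ▸ Nat.dvd_gcd h1 (hmM l hl h2)))
    · have : IsCoprime (n : ℤ) M := Nat.isCoprime_iff_coprime.2 hnM
      exact Int.isCoprime_iff_gcd_eq_one.1 (this.of_isCoprime_of_dvd_right habM')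
  have hJq : jacobiSym (-(a * b)) q = 1 := by
    rw [← hJn, jacobiSym.mod_right _ (odd_of q hqM), jacobiSym.mod_right _ (odd_of n hnM)]
    congr 1
    apply hqn.of_dvd
    have := Int.natAbs_dvd_natAbs.2 habM
    rw [Int.natAbs_mul] at this
    simpa using this
  set u : ℤ := m * q with hu
  have hu0 : 0 < u := by
    have := hq.pos; positivity
  have hH : Hil ℚ ((a * u : ℤ) : ℚ) ((b * u : ℤ) : ℚ) := by
    apply hil_global _ (a * u) (b * u) le_rfl (by positivity) (by positivity) (Or.inl (by positivity))
    intro p hp hp2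
    have hp2' : ¬ p ∣ 2 := fun h' => hp2 ((Nat.prime_dvd_prime_iff_eq hp.out Nat.prime_two).1 h')
    have hu' : (u : ℚ_[p]) ≠ 0 := by exact_mod_cast hu0.ne'
    by_cases hpM : p ∣ M
    · have hpn : ¬ (p : ℤ) ∣ n := by
        intro h'
        exact hp.out.one_lt.ne' (Nat.dvd_one.1 (hnM ▸ Nat.dvd_gcd (by exact_mod_cast h') hpM))
      have hd : (p : ℤ) ∣ (q - n : ℤ) := by
        have h1 := hqn.symm.dvd
        exact (Int.natCast_dvd_natCast.2 hpM).trans h1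
      obtain ⟨s, hs0, hs⟩ := sq_of_near (p := p) (u := ((n : ℤ) : ℚ_[p])) (u' := ((q : ℤ) : ℚ_[p])) (by
        rw [norm_four hp2, norm_unit hpn, ← Int.cast_sub, mul_one]
        exact Padic.norm_intCast_lt_one_iff.2 hd)
      refine ⟨x * s, y * s, u, Or.inr (Or.inr hu'), ?_⟩
      have h' : (m : ℚ_[p]) * n = a * x ^ 2 + b * y ^ 2 := by exact_mod_cast congrArg (Int.cast : ℤ → ℚ_[p]) h
      simp only [hu, Int.cast_mul, Int.cast_natCast] at hs ⊢
      linear_combination (m : ℚ_[p]) * q * m * hs + (m : ℚ_[p]) * q * s ^ 2 * h'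
    · have hpab : ¬ (p : ℤ) ∣ a * b := fun h' => hpM (by exact_mod_cast h'.trans habM')
      by_cases hpq : p = q
      · subst hpq
        rw [← jacobiSym.legendreSym.to_jacobiSym, legendreSym.eq_one_iff _ (by
          rw [Ne, ZMod.intCast_zmod_eq_zero_iff_dvd, dvd_neg]; exact hpab)] at hJq
        obtain ⟨s, hs⟩ := hJq
        obtain ⟨s, rfl⟩ := ZMod.intCast_surjective s
        rw [← Int.cast_mul, ZMod.intCast_eq_intCast_iff_dvd_sub] at hs
        have hps : ¬ (p : ℤ) ∣ s * s := fun h' => hpab (by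
          have := dvd_sub h' hs
          rw [← dvd_neg]
          convert this using 1; ring)
        obtain ⟨t, ht0, ht⟩ := sq_of_near (p := p) (u := ((s * s : ℤ) : ℚ_[p])) (u' := ((-(a * b) : ℤ) : ℚ_[p])) (by
          rw [norm_four hp2, norm_unit hps, ← Int.cast_sub, mul_one]
          apply Padic.norm_intCast_lt_one_iff.2
          exact (dvd_sub_comm).1 hs)
        refine ⟨s * t, a, 0, Or.inr (Or.inl (by exact_mod_cast ha.ne')), ?_⟩
        push_cast at ht ⊢
        linear_combination (a : ℚ_[p]) * u * ht
      · have hpm : ¬ p ∣ m := fun h' => hpM (hmM p hp.out h')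
        have hpq' : ¬ p ∣ q := fun h' => hpq ((Nat.prime_dvd_prime_iff_eq hp.out hq).1 h')
        have hpu : ¬ (p : ℤ) ∣ -u := by
          rw [dvd_neg, hu]
          intro h'
          have h'' : p ∣ m * q := by exact_mod_cast h'
          rcases (Nat.Prime.dvd_mul hp.out).1 h'' with h | h
          · exact hpm h
          · exact hpq' h
        obtain ⟨v, hv, e⟩ := iso3_units hp2 a b (-u) (fun h' => hpab (h'.mul_right _))
          (fun h' => hpab (h'.mul_left _)) hpu
        simp [Fin.sum_univ_three] at e
        refine ⟨v 0, v 1, u * v 2, ?_, ?_⟩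
        · by_contra hcon
          push Not at hcon
          obtain ⟨h0, h1, h2⟩ := hcon
          apply hv
          funext i; fin_cases i
          · exact h0
          · exact h1
          · simpa [hu'] using h2
        · push_cast
          linear_combination -(u : ℚ_[p]) * e
  have huq : (u : ℚ) = m * q := by simp [hu]
  have hu' : (u : ℚ) ≠ 0 := by exact_mod_cast hu0.ne'
  rw [← huq]
  obtain ⟨X, Y, Z, hne, e⟩ := hH
  push_cast at e
  by_cases hZ : Z = 0
  · have hiso : IsoF ![(a : ℚ), b] := by
      refine ⟨![X, Y], ?_, ?_⟩
      · intro h'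
        have h1 := congrFun h' 0
        have h2 := congrFun h' 1
        simp at h1 h2
        simp_all
      · simp
        have : (u : ℚ) * (a * X ^ 2 + b * Y ^ 2) = 0 := by rw [hZ] at e; linear_combination -e
        simpa [hu'] using this
    obtain ⟨w, hw⟩ := hiso.represents (by
      intro j; fin_cases j
      · simpa using ha.ne'
      · simpa) (u : ℚ)
    simp [Fin.sum_univ_two] at hw
    exact ⟨_, _, hw⟩
  · refine ⟨X * u / Z, Y * u / Z, ?_⟩
    field_simp
    linear_combination -e

/-- Local-global for quaternary forms (with the needed sign pattern). -/
theorem iso4_global (a b c d : ℤ) (ha : 0 < a) (hb : b ≠ 0) (hc : c < 0) (hd : d ≠ 0)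
    (h : ∀ (p : ℕ) [Fact p.Prime], IsoF ![(a : ℚ_[p]), b, c, d]) : IsoF ![(a : ℚ), b, c, d] := by
  set M : ℕ := (4 * (a * b) * (c * d)).natAbs with hMdef
  have hM : M ≠ 0 := by
    rw [hMdef, Int.natAbs_ne_zero]
    have := ha.ne'
    have := hc.ne
    positivity
  have hM1 : 4 * (a * b) ∣ (M : ℤ) := by rw [hMdef, Int.dvd_natAbs]; exact Dvd.intro _ rfl
  have hM2 : 4 * (-c * -d) ∣ (M : ℤ) := by
    rw [hMdef, Int.dvd_natAbs]; exact ⟨a * b, by ring⟩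
  have hloc : ∀ p : ℕ, ∃ k : ℕ, p.Prime → ∀ K : ℕ, k ≤ K → ∃ X Y Z W : ℕ,
      (p : ℤ) ^ K ∣ a * X ^ 2 + b * Y ^ 2 + c * Z ^ 2 + d * W ^ 2 ∧
      ¬ (p : ℤ) ^ k ∣ a * X ^ 2 + b * Y ^ 2 := by
    intro p
    by_cases hp : p.Prime
    · have : Fact p.Prime := ⟨hp⟩
      obtain ⟨k, hk⟩ := loc4 a b c d ha.ne' hb hc.ne hd (h p)
      exact ⟨k, fun _ => hk⟩
    · exact ⟨0, fun h' => absurd h' hp⟩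
  choose kf hkf using hloc
  set k := M.primeFactors.sup kf with hk
  have hkp : ∀ p ∈ M.primeFactors, kf p ≤ k := fun p hp => Finset.le_sup hp
  set N := M ^ (k + 1) with hN
  have hN0 : N ≠ 0 := pow_ne_zero _ hM
  have hfac : ∀ p ∈ M.primeFactors, k + 1 ≤ N.factorization p := by
    intro p hp
    rw [hN, Nat.factorization_pow]
    simp only [Finsupp.smul_apply, smul_eq_mul]
    have := (Nat.prime_of_mem_primeFactors hp).factorization_pos_of_dvd hM (Nat.dvd_of_mem_primeFactors hp)
    nlinarith
  have hNp : N.primeFactors = M.primeFactors := Nat.primeFactors_pow _ (by omega)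
  have hex : ∀ p : ℕ, ∃ X Y Z W : ℕ, p ∈ M.primeFactors →
      ((p : ℤ) ^ (N.factorization p) ∣ a * X ^ 2 + b * Y ^ 2 + c * Z ^ 2 + d * W ^ 2 ∧
      ¬ (p : ℤ) ^ k ∣ a * X ^ 2 + b * Y ^ 2) := by
    intro p
    by_cases hp : p ∈ M.primeFactors
    · obtain ⟨X, Y, Z, W, h1, h2⟩ := hkf p (Nat.prime_of_mem_primeFactors hp) (N.factorization p)
        (by have := hkp p hp; have := hfac p hp; omega)
      exact ⟨X, Y, Z, W, fun _ => ⟨h1, fun h' => h2 ((pow_dvd_pow _ (hkp p hp)).trans h')⟩⟩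
    · exact ⟨0, 0, 0, 0, fun h' => absurd h' hp⟩
  choose X Y Z W hXYZW using hex
  obtain ⟨y, -, hy⟩ := crt N hN0 Y 0
  obtain ⟨w, -, hw⟩ := crt N hN0 W 0
  obtain ⟨x, hxB, hx⟩ := crt N hN0 X (b.natAbs * y + 1)
  obtain ⟨z, hzB, hz⟩ := crt N hN0 Z (d.natAbs * w + 1)
  rw [hNp] at hx hy hz hw
  have pos_aux : ∀ (a b : ℤ) (x y : ℕ), 0 < a → b.natAbs * y + 1 ≤ x → 0 < a * (x : ℤ) ^ 2 + b * (y : ℤ) ^ 2 := by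
    intro a b x y ha hx
    have h1 : |b| * y + 1 ≤ (x : ℤ) := by
      have : ((b.natAbs * y + 1 : ℕ) : ℤ) ≤ x := by exact_mod_cast hx
      simpa using this
    have h2 : (|b| * y + 1) ^ 2 ≤ (x : ℤ) ^ 2 := by gcongr
    have h3 : |b| ≤ |b| ^ 2 := by
      rcases eq_or_ne b 0 with rfl | hb
      · simp
      · have := abs_pos.2 hb
        nlinarith
    have h4 : (x : ℤ) ^ 2 ≤ a * x ^ 2 := by nlinarith [sq_nonneg (x : ℤ)]
    have h5 : -|b| * (y : ℤ) ^ 2 ≤ b * y ^ 2 := by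
      apply mul_le_mul_of_nonneg_right (neg_abs_le b) (sq_nonneg _)
    have h6 : |b| * (y : ℤ) ^ 2 ≤ |b| ^ 2 * y ^ 2 := mul_le_mul_of_nonneg_right h3 (sq_nonneg _)
    have h7 : 0 ≤ |b| * (y : ℤ) := by positivity
    nlinarith
  have hu0 := pos_aux a b x y ha hxB
  have hu1 := pos_aux (-c) (-d) z w (by omega) (by simpa using hzB)
  obtain ⟨u0, hu0e⟩ := Int.eq_ofNat_of_zero_le hu0.le
  obtain ⟨u1, hu1e⟩ := Int.eq_ofNat_of_zero_le hu1.le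
  have hu0p : u0 ≠ 0 := by rintro rfl; rw [hu0e] at hu0; simp at hu0
  have hu1p : u1 ≠ 0 := by rintro rfl; rw [hu1e] at hu1; simp at hu1
  have hdiff : (N : ℤ) ∣ u0 - u1 := by
    apply dvd_of_local N hN0
    intro p hp
    rw [hNp] at hp
    have h1 := dvd_add (dvd_add (quad_dvd a (hx p hp)) (quad_dvd b (hy p hp))) (dvd_add (quad_dvd c (hz p hp)) (quad_dvd d (hw p hp)))
    have h2 := dvd_add h1 (hXYZW p hp).1
    have e : (u0 : ℤ) - u1 = a * x ^ 2 - a * X p ^ 2 + (b * y ^ 2 - b * Y p ^ 2) +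
        (c * z ^ 2 - c * Z p ^ 2 + (d * w ^ 2 - d * W p ^ 2)) +
        (a * X p ^ 2 + b * Y p ^ 2 + c * Z p ^ 2 + d * W p ^ 2) := by
      linear_combination -hu0e + hu1e
    rw [e]; exact h2
  have hndvd : ∀ p ∈ M.primeFactors, ¬ p ^ k ∣ u0 := by
    intro p hp h'
    apply (hXYZW p hp).2
    have h0 : (p : ℤ) ^ k ∣ u0 := by exact_mod_cast h'
    have h1 := (pow_dvd_pow (p : ℤ) (show k ≤ N.factorization p by have := hfac p hp; omega)).trans
      (dvd_add (quad_dvd a (hx p hp)) (quad_dvd b (hy p hp)))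
    have h2 := dvd_sub h0 h1
    have e : a * (X p : ℤ) ^ 2 + b * Y p ^ 2 = u0 - (a * x ^ 2 - a * X p ^ 2 + (b * y ^ 2 - b * Y p ^ 2)) := by
      linear_combination hu0e
    rw [e]; exact h2
  set m := Nat.gcd u0 (M ^ k) with hm
  have hm0 : m ≠ 0 := (Nat.gcd_pos_of_pos_left _ (Nat.pos_of_ne_zero hu0p)).ne'
  obtain ⟨n0, hn0⟩ : m ∣ u0 := Nat.gcd_dvd_left _ _
  obtain ⟨r, hr⟩ : m ∣ M ^ k := Nat.gcd_dvd_right _ _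
  have hn0r : n0.Coprime r := by
    have e1 : n0 = u0 / m := by rw [hn0]; exact (Nat.mul_div_cancel_left _ (Nat.pos_of_ne_zero hm0)).symm
    have e2 : r = M ^ k / m := by rw [hr]; exact (Nat.mul_div_cancel_left _ (Nat.pos_of_ne_zero hm0)).symm
    rw [e1, e2, hm]
    exact Nat.coprime_div_gcd_div_gcd (Nat.gcd_pos_of_pos_left _ (Nat.pos_of_ne_zero hu0p))
  have hn0M : n0.Coprime M := by
    apply Nat.coprime_of_dvd
    intro l hl h1 h2
    have hlr : ¬ l ∣ r := fun h' => hl.one_lt.ne' (Nat.dvd_one.1 (hn0r ▸ Nat.dvd_gcd h1 h'))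
    have h3 : l ^ k ∣ m * r := by rw [← hr]; exact pow_dvd_pow_of_dvd h2 k
    have h4 : l ^ k ∣ m := (Nat.Coprime.pow_left k ((Nat.Prime.coprime_iff_not_dvd hl).2 hlr)).dvd_of_dvd_mul_right h3
    exact hndvd l (Nat.mem_primeFactors.2 ⟨hl, h2, hM⟩) (h4.trans (Nat.gcd_dvd_left _ _))
  have hmN : (m : ℤ) * M ∣ u0 - u1 := by
    refine dvd_trans ?_ hdiff
    rw [hN, pow_succ]
    push_cast
    exact mul_dvd_mul_right (by exact_mod_cast (Nat.gcd_dvd_right _ _ : m ∣ M ^ k)) _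
  obtain ⟨n1, hn1⟩ : m ∣ u1 := by
    have h1 : (m : ℤ) ∣ u0 - u1 := (Dvd.intro _ rfl).trans hmN
    have h2 : (m : ℤ) ∣ u0 := by exact_mod_cast (Nat.gcd_dvd_left _ _ : m ∣ u0)
    have h3 := dvd_sub h2 h1
    rw [sub_sub_cancel] at h3
    exact_mod_cast h3
  have hcong : n1 ≡ n0 [MOD M] := by
    rw [Nat.modEq_iff_dvd]
    have : (m : ℤ) * M ∣ m * (n0 - n1) := by
      convert hmN using 1
      rw [hn0, hn1]; push_cast; ring
    exact (mul_dvd_mul_iff_left (by exact_mod_cast hm0)).1 this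
  have hn1M : n1.Coprime M := by rw [Nat.Coprime, hcong.gcd_eq]; exact hn0M
  have : NeZero M := ⟨hM⟩
  obtain ⟨q, -, hq, hqn⟩ := Nat.forall_exists_prime_gt_and_modEq 0 hM hn0M
  have hmM : ∀ l : ℕ, l.Prime → l ∣ m → l ∣ M := fun l hl h' =>
    hl.dvd_of_dvd_pow (h'.trans (Nat.gcd_dvd_right _ _))
  obtain ⟨A, B, hAB⟩ := ternary_dirichlet a b ha hb M m n0 q x y hq hM1 hm0
    (by rintro rfl; simp at hn0; exact hu0p hn0) (by rw [hu0e, hn0]; simp) hn0M hqn hmM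
  obtain ⟨C, D, hCD⟩ := ternary_dirichlet (-c) (-d) (by omega) (by simpa using hd) M m n1 q z w hq hM2 hm0
    (by rintro rfl; simp at hn1; exact hu1p hn1) (by rw [hu1e, hn1]; simp) hn1M (hqn.trans hcong.symm) hmM
  refine ⟨![A, B, C, D], ?_, ?_⟩
  · intro h'
    have h1 := congrFun h' 0
    have h2 := congrFun h' 1
    simp at h1 h2
    rw [h1, h2] at hAB
    have : (m : ℚ) * q ≠ 0 := by
      have := hq.ne_zero
      positivity
    apply this
    rw [← hAB]; ring
  · simp [Fin.sum_univ_four]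
    push_cast at hCD
    linear_combination hAB - hCD

end Paper


namespace Paper

theorem pos_aux (a b : ℤ) (x y : ℕ) (ha : 0 < a) (hx : b.natAbs * y + 1 ≤ x) :
    0 < a * (x : ℤ) ^ 2 + b * (y : ℤ) ^ 2 := by
  have h1 : |b| * y + 1 ≤ (x : ℤ) := by
    have : ((b.natAbs * y + 1 : ℕ) : ℤ) ≤ x := by exact_mod_cast hx
    simpa using this
  have h2 : (|b| * y + 1) ^ 2 ≤ (x : ℤ) ^ 2 := by gcongr
  have h3 : |b| ≤ |b| ^ 2 := by
    rcases eq_or_ne b 0 with rfl | hb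
    · simp
    · have := abs_pos.2 hb
      nlinarith
  have h4 : (x : ℤ) ^ 2 ≤ a * x ^ 2 := by nlinarith [sq_nonneg (x : ℤ)]
  have h5 : -|b| * (y : ℤ) ^ 2 ≤ b * y ^ 2 := by
    apply mul_le_mul_of_nonneg_right (neg_abs_le b) (sq_nonneg _)
  have h6 : |b| * (y : ℤ) ^ 2 ≤ |b| ^ 2 * y ^ 2 := mul_le_mul_of_nonneg_right h3 (sq_nonneg _)
  have h7 : 0 ≤ |b| * (y : ℤ) := by positivity
  nlinarith

theorem loc5 {p : ℕ} [hp : Fact p.Prime] (a b c d e : ℤ) (ha : a ≠ 0) (hb : b ≠ 0) (hc : c ≠ 0)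
    (hd : d ≠ 0) (he : e ≠ 0) :
    ∃ k X Y : ℕ, ∀ x y : ℤ, (p : ℤ) ^ k ∣ x - X → (p : ℤ) ^ k ∣ y - Y →
      IsoF ![((a * x ^ 2 + b * y ^ 2 : ℤ) : ℚ_[p]), c, d, e] := by
  obtain ⟨v, hv, h⟩ := iso5_local p ![a, b, c, d, e] (by intro i; fin_cases i <;> simpa)
  simp [Fin.sum_univ_five] at h
  obtain ⟨x, y, w, h1, h2⟩ := iso_split (a := (a : ℚ_[p])) (b := b) (e := ![(c : ℚ_[p]), d, e])
    (by exact_mod_cast ha) (by exact_mod_cast hb)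
    (by intro i; fin_cases i <;> simpa) (v 0) (v 1) ![v 2, v 3, v 4] (by
      by_contra hcon
      push Not at hcon
      obtain ⟨h0, h1, h2⟩ := hcon
      apply hv
      have h3 := congrFun h2 0
      have h4 := congrFun h2 1
      have h5 := congrFun h2 2
      simp at h3 h4 h5
      funext i; fin_cases i <;> simpa) (by simp [Fin.sum_univ_three]; linear_combination h)
  simp [Fin.sum_univ_three] at h2
  obtain ⟨N, hN⟩ := exists_scale ![x, y]
  have hp0 : (p : ℚ_[p]) ≠ 0 := by exact_mod_cast hp.out.ne_zero
  set P := (p : ℚ_[p]) ^ N with hP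
  have hP0 : P ≠ 0 := pow_ne_zero _ hp0
  obtain ⟨x', hx'⟩ : ∃ t : ℤ_[p], (t : ℚ_[p]) = P * x := ⟨⟨P * x, hN 0⟩, rfl⟩
  obtain ⟨y', hy'⟩ : ∃ t : ℤ_[p], (t : ℚ_[p]) = P * y := ⟨⟨P * y, hN 1⟩, rfl⟩
  set t : ℤ_[p] := a * x' ^ 2 + b * y' ^ 2 with ht
  have htc : (t : ℚ_[p]) = P ^ 2 * (a * x ^ 2 + b * y ^ 2) := by
    simp [ht, hx', hy']; ring
  have ht0 : (t : ℚ_[p]) ≠ 0 := by rw [htc]; exact mul_ne_zero (pow_ne_zero _ hP0) h1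
  have hpos : 0 < ‖(4 : ℚ_[p])‖ * ‖(t : ℚ_[p])‖ :=
    mul_pos (norm_pos_iff.2 (by norm_num)) (norm_pos_iff.2 ht0)
  have hp1 : (1 : ℝ) < p := by exact_mod_cast hp.out.one_lt
  obtain ⟨k, hk⟩ := pow_unbounded_of_one_lt ((‖(4 : ℚ_[p])‖ * ‖(t : ℚ_[p])‖)⁻¹) hp1
  obtain ⟨X, hX⟩ := appr_dvd x' k
  obtain ⟨Y, hY⟩ := appr_dvd y' k
  refine ⟨k, X, Y, fun x₁ y₁ hx₁ hy₁ => ?_⟩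
  have cast_dvd : ∀ z : ℤ, (p : ℤ) ^ k ∣ z → (p : ℤ_[p]) ^ k ∣ (z : ℤ_[p]) := by
    intro z hz
    have := (Int.castRingHom ℤ_[p]).map_dvd hz
    simpa using this
  have hx₂ : (p : ℤ_[p]) ^ k ∣ (x₁ : ℤ_[p]) - x' := by
    have := dvd_sub (cast_dvd _ hx₁) hX
    have e : (x₁ : ℤ_[p]) - x' = ((x₁ - X : ℤ) : ℤ_[p]) - (x' - X) := by push_cast; ring
    rw [e]; exact this
  have hy₂ : (p : ℤ_[p]) ^ k ∣ (y₁ : ℤ_[p]) - y' := by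
    have := dvd_sub (cast_dvd _ hy₁) hY
    have e : (y₁ : ℤ_[p]) - y' = ((y₁ - Y : ℤ) : ℤ_[p]) - (y' - Y) := by push_cast; ring
    rw [e]; exact this
  have h3 : (p : ℤ_[p]) ^ k ∣ ((a * x₁ ^ 2 + b * y₁ ^ 2 : ℤ) : ℤ_[p]) - t := by
    have := dvd_add (quad_dvd (a : ℤ_[p]) hx₂) (quad_dvd (b : ℤ_[p]) hy₂)
    have e : ((a * x₁ ^ 2 + b * y₁ ^ 2 : ℤ) : ℤ_[p]) - t = a * x₁ ^ 2 - a * x' ^ 2 + (b * y₁ ^ 2 - b * y' ^ 2) := by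
      rw [ht]; push_cast; ring
    rw [e]; exact this
  have h4 := (PadicInt.norm_le_pow_iff_mem_span_pow _ k).2 (Ideal.mem_span_singleton.2 h3)
  rw [zpow_neg, zpow_natCast] at h4
  have h5 : ‖((a * x₁ ^ 2 + b * y₁ ^ 2 : ℤ) : ℚ_[p]) - t‖ < ‖(4 : ℚ_[p])‖ * ‖(t : ℚ_[p])‖ := by
    have e : ‖((a * x₁ ^ 2 + b * y₁ ^ 2 : ℤ) : ℤ_[p]) - t‖ = ‖((a * x₁ ^ 2 + b * y₁ ^ 2 : ℤ) : ℚ_[p]) - t‖ := by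
      rw [PadicInt.norm_def]; push_cast; rfl
    rw [← e]
    refine h4.trans_lt ?_
    rw [inv_lt_comm₀ (by positivity) hpos]
    exact hk
  obtain ⟨s, hs0, hs⟩ := sq_of_near h5
  refine ⟨![1, P * s * w 0, P * s * w 1, P * s * w 2], ?_, ?_⟩
  · intro h'
    simpa using congrFun h' 0
  · simp only [Fin.sum_univ_four]
    simp
    push_cast at hs
    rw [hs, htc]
    linear_combination (P * s) ^ 2 * h2

theorem meyer_int (a b c d e : ℤ) (ha : 0 < a) (hb : b ≠ 0) (hc : c < 0) (hd : d ≠ 0) (he : e ≠ 0) :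
    IsoF ![(a : ℚ), b, c, d, e] := by
  set M : ℕ := (2 * (a * b * c * d * e)).natAbs with hMdef
  have hM : M ≠ 0 := by
    rw [hMdef, Int.natAbs_ne_zero]
    have := ha.ne'
    have := hc.ne
    positivity
  have hloc : ∀ p : ℕ, ∃ k X Y : ℕ, ∀ [Fact p.Prime], ∀ x y : ℤ, (p : ℤ) ^ k ∣ x - X → (p : ℤ) ^ k ∣ y - Y →
      IsoF ![((a * x ^ 2 + b * y ^ 2 : ℤ) : ℚ_[p]), d, c, e] := by
    intro p
    by_cases hp : p.Prime
    · have : Fact p.Prime := ⟨hp⟩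
      obtain ⟨k, X, Y, h⟩ := loc5 (p := p) a b d c e ha.ne' hb hd hc.ne he
      exact ⟨k, X, Y, h⟩
    · exact ⟨0, 0, 0, fun {h'} => absurd h'.out hp⟩
  choose kf X Y hkf using hloc
  set k := M.primeFactors.sup kf with hk
  have hkp : ∀ p ∈ M.primeFactors, kf p ≤ k := fun p hp => Finset.le_sup hp
  set N := M ^ (k + 1) with hN
  have hN0 : N ≠ 0 := pow_ne_zero _ hM
  have hfac : ∀ p ∈ M.primeFactors, k + 1 ≤ N.factorization p := by
    intro p hp
    rw [hN, Nat.factorization_pow]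
    simp only [Finsupp.smul_apply, smul_eq_mul]
    have := (Nat.prime_of_mem_primeFactors hp).factorization_pos_of_dvd hM (Nat.dvd_of_mem_primeFactors hp)
    nlinarith
  have hNp : N.primeFactors = M.primeFactors := Nat.primeFactors_pow _ (by omega)
  obtain ⟨y, -, hy⟩ := crt N hN0 Y 0
  obtain ⟨x, hxB, hx⟩ := crt N hN0 X (b.natAbs * y + 1)
  rw [hNp] at hx hy
  have ht := pos_aux a b x y ha hxB
  obtain ⟨v, hv, h⟩ := iso4_global (a * x ^ 2 + b * y ^ 2) d c e ht hd hc he (by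
    intro p hp
    by_cases hpM : p ∣ M
    · have hpm : p ∈ M.primeFactors := Nat.mem_primeFactors.2 ⟨hp.out, hpM, hM⟩
      have hle : kf p ≤ N.factorization p := by
        have := hkp p hpm; have := hfac p hpm; omega
      exact hkf p x y ((pow_dvd_pow _ hle).trans (hx p hpm)) ((pow_dvd_pow _ hle).trans (hy p hpm))
    · have key : ∀ z : ℤ, z ∣ 2 * (a * b * c * d * e) → ¬ (p : ℤ) ∣ z := by
        intro z hz h'
        apply hpM
        rw [hMdef, ← Int.natCast_dvd]
        exact h'.trans hz
      have hp2 : p ≠ 2 := by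
        rintro rfl
        exact key 2 (Dvd.intro _ rfl) (by simp)
      have := iso3_units hp2 d c e (key d ⟨2 * a * b * c * e, by ring⟩)
        (key c ⟨2 * a * b * d * e, by ring⟩) (key e ⟨2 * a * b * c * d, by ring⟩)
      apply IsoF.of_inj Fin.succ (Fin.succ_injective _)
      convert this using 1
      funext i; fin_cases i <;> rfl)
  simp [Fin.sum_univ_four] at h
  by_cases h0 : v 0 = 0
  · refine ⟨![0, 0, v 2, v 1, v 3], ?_, ?_⟩
    · intro h'
      apply hv
      have h1 := congrFun h' 2
      have h2 := congrFun h' 3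
      have h3 := congrFun h' 4
      simp at h1 h2 h3
      funext i; fin_cases i <;> simpa
    · simp [Fin.sum_univ_five]
      rw [h0] at h
      linear_combination h
  · refine ⟨![x * v 0, y * v 0, v 2, v 1, v 3], ?_, ?_⟩
    · intro h'
      have h1 := congrFun h' 0
      simp [h0] at h1
      rw [h1] at hxB
      omega
    · simp [Fin.sum_univ_five]
      linear_combination h

theorem meyer_five (d : Fin 5 → ℚ) (hd : ∀ i, d i ≠ 0) (i j : Fin 5) (hi : 0 < d i) (hj : d j < 0) :
    IsoF d := by
  have hij : i ≠ j := by rintro rfl; linarith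
  let σ : Equiv.Perm (Fin 5) := Equiv.swap 0 i
  let τ : Equiv.Perm (Fin 5) := σ.trans (Equiv.swap (σ 2) j)
  have hσ0 : σ 0 = i := Equiv.swap_apply_left _ _
  have hσ2 : σ 2 ≠ i := by rw [← hσ0]; exact fun h => by simpa using σ.injective h
  have hτ0 : τ 0 = i := by
    simp only [τ, Equiv.trans_apply, hσ0]
    exact Equiv.swap_apply_of_ne_of_ne hσ2.symm hij
  have hτ2 : τ 2 = j := by simp only [τ, Equiv.trans_apply, Equiv.swap_apply_left]
  apply IsoF.of_inj τ τ.injective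
  let n : Fin 5 → ℤ := fun k => (d (τ k)).num * (d (τ k)).den
  have hn : ∀ k, (n k : ℚ) = d (τ k) * (d (τ k)).den ^ 2 := by
    intro k
    have := Rat.num_div_den (d (τ k))
    have h0 : ((d (τ k)).den : ℚ) ≠ 0 := by exact_mod_cast (d (τ k)).den_ne_zero
    simp only [n]
    push_cast
    nth_rw 3 [← Rat.num_div_den (d (τ k))]
    field_simp
  have hn0 : ∀ k, n k ≠ 0 := fun k => mul_ne_zero (Rat.num_ne_zero.2 (hd _)) (by exact_mod_cast (d (τ k)).den_ne_zero)
  have h0 : 0 < n 0 := by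
    have : 0 < d (τ 0) := by rw [hτ0]; exact hi
    have h1 := Rat.num_pos.2 this
    have h2 := (d (τ 0)).den_pos
    simp only [n]; positivity
  have h2 : n 2 < 0 := by
    have : d (τ 2) < 0 := by rw [hτ2]; exact hj
    have h1 := Rat.num_neg.2 this
    have h2 : (0 : ℤ) < (d (τ 2)).den := by exact_mod_cast (d (τ 2)).den_pos
    exact mul_neg_of_neg_of_pos h1 h2
  have := meyer_int (n 0) (n 1) (n 2) (n 3) (n 4) h0 (hn0 1) h2 (hn0 3) (hn0 4)
  refine IsoF.scale 1 (fun k => ((d (τ k)).den : ℚ)) (fun k => by exact_mod_cast (d (τ k)).den_ne_zero) ?_ this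
  intro k
  rw [← hn, one_mul]
  fin_cases k <;> rfl

theorem meyer {ι : Type*} [Fintype ι] (d : ι → ℚ) (hd : ∀ i, d i ≠ 0) (hc : 5 ≤ Fintype.card ι)
    (i j : ι) (hi : 0 < d i) (hj : d j < 0) : IsoF d := by
  classical
  obtain ⟨s, hs, hcard⟩ := Finset.exists_superset_card_eq (s := {i, j}) (n := 5)
    ((Finset.card_le_two).trans (by norm_num)) hc
  let e := (s.equivFinOfCardEq hcard).symm
  have his : i ∈ s := hs (by simp)
  have hjs : j ∈ s := hs (by simp)
  apply IsoF.of_inj (fun k => (e k : ι)) (Subtype.val_injective.comp e.injective)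
  exact meyer_five _ (fun k => hd _) (e.symm ⟨i, his⟩) (e.symm ⟨j, hjs⟩) (by simpa using hi) (by simpa using hj)

end Paper


namespace Paper

open QuadraticMap in
theorem peel {n : ℕ} (Q : QuadraticForm ℚ (Fin n → ℚ)) (v : Fin n → ℚ) (a : ℚ) (ha : a ≠ 0)
    (hv : Q v = a) : ∃ (m : ℕ) (h : Fin m → ℚ) (e : (ℚ × (Fin m → ℚ)) ≃ₗ[ℚ] (Fin n → ℚ)),
      n = m + 1 ∧ ∀ t y, Q (e (t, y)) = a * (t * t) + weightedSumSquares ℚ h y := by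
  let φ : (Fin n → ℚ) →ₗ[ℚ] ℚ := Q.polarBilin v
  have hφ : ∀ x, φ x = polar Q v x := fun x => rfl
  have hφv : φ v = 2 * a := by rw [hφ, polar_self, hv]; simp
  let W := LinearMap.ker φ
  let f : (ℚ × W) →ₗ[ℚ] (Fin n → ℚ) :=
    LinearMap.coprod (LinearMap.toSpanSingleton ℚ _ v) W.subtype
  have hf : ∀ t w, f (t, w) = t • v + (w : Fin n → ℚ) := by
    intro t w; simp [f]
  have hinj : Function.Injective f := by
    rw [← LinearMap.ker_eq_bot, LinearMap.ker_eq_bot']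
    rintro ⟨t, w⟩ h
    rw [hf] at h
    have h1 := congrArg φ h
    have hw : φ w = 0 := w.2
    rw [map_add, map_smul, hw, hφv] at h1
    have ht : t = 0 := by simpa [ha] using h1
    subst ht
    have : (w : Fin n → ℚ) = 0 := by simpa using h
    ext1
    · rfl
    · exact Subtype.ext this
  have hsurj : Function.Surjective f := by
    intro x
    have hmem : x - (φ x / (2 * a)) • v ∈ W := by
      simp only [W, LinearMap.mem_ker, map_sub, map_smul, hφv, smul_eq_mul]
      field_simp
      ring
    refine ⟨(φ x / (2 * a), ⟨_, hmem⟩), ?_⟩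
    rw [hf]; simp
  let e0 := LinearEquiv.ofBijective f ⟨hinj, hsurj⟩
  obtain ⟨h, ⟨g⟩⟩ := QuadraticForm.equivalent_weightedSumSquares (Q.restrict W)
  let e : (ℚ × (Fin (Module.finrank ℚ W) → ℚ)) ≃ₗ[ℚ] (Fin n → ℚ) :=
    (LinearEquiv.prodCongr (LinearEquiv.refl ℚ ℚ) g.toLinearEquiv.symm).trans e0
  refine ⟨_, h, e, ?_, ?_⟩
  · have := e0.finrank_eq
    simp at this
    omega
  · intro t y
    have h1 : e (t, y) = t • v + ((g.symm y : W) : Fin n → ℚ) := hf _ _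
    have h2 : φ (g.symm y : W) = 0 := (g.symm y : W).2
    rw [h1, QuadraticMap.map_add (f := Q), QuadraticMap.map_smul, hv, polar_smul_left, ← hφ, h2]
    have h3 := g.symm.map_app y
    rw [restrict_apply] at h3
    rw [h3]
    simp [mul_comm]

theorem wss {ι : Type*} [Fintype ι] (w v : ι → ℚ) :
    QuadraticMap.weightedSumSquares ℚ w v = ∑ i, w i * v i ^ 2 := by
  simp [QuadraticMap.weightedSumSquares_apply, pow_two]

noncomputable def cntPos {ι : Type*} [Fintype ι] (w : ι → ℚ) : ℕ := ∑ i, if 0 < w i then 1 else 0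

noncomputable def cntNeg {ι : Type*} [Fintype ι] (w : ι → ℚ) : ℕ := ∑ i, if w i < 0 then 1 else 0

theorem sigPos_eq_cnt {ι : Type*} [Fintype ι] (w : ι → ℚ) :
    sigPos (QuadraticMap.weightedSumSquares ℚ w) = cntPos w := by
  classical
  rw [QuadraticForm.sigPos_weightedSumSquares, Set.ncard_eq_toFinset_card', cntPos, Set.toFinset_ofPred, Finset.card_filter]

theorem sigNeg_eq_cnt {ι : Type*} [Fintype ι] (w : ι → ℚ) :
    sigNeg (QuadraticMap.weightedSumSquares ℚ w) = cntNeg w := by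
  classical
  rw [QuadraticForm.sigNeg_weightedSumSquares, Set.ncard_eq_toFinset_card', cntNeg, Set.toFinset_ofPred, Finset.card_filter]

theorem nonzero_of_cnt {ι : Type*} [Fintype ι] (w : ι → ℚ) (h : Fintype.card ι ≤ cntPos w + cntNeg w) (i : ι) :
    w i ≠ 0 := by
  intro hi
  have : cntPos w + cntNeg w < ∑ i : ι, 1 := by
    rw [cntPos, cntNeg, ← Finset.sum_add_distrib]
    apply Finset.sum_lt_sum
    · intro j _
      split_ifs <;> first | omega | linarith
    · exact ⟨i, Finset.mem_univ _, by simp [hi]⟩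
  simp at this
  omega

theorem exists_value {n : ℕ} (Q : QuadraticForm ℚ (Fin n → ℚ)) (hn : 4 ≤ n)
    (hQ : n ≤ sigPos Q + sigNeg Q) (a : ℚ) (ha : a ≠ 0)
    (h1 : 0 < a → 0 < sigPos Q) (h2 : a < 0 → 0 < sigNeg Q) : ∃ v, Q v = a := by
  obtain ⟨d, hd⟩ := QuadraticForm.equivalent_weightedSumSquares Q
  rw [hd.sigPos_eq, hd.sigNeg_eq, sigPos_eq_cnt, sigNeg_eq_cnt] at hQ
  rw [hd.sigPos_eq, sigPos_eq_cnt] at h1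
  rw [hd.sigNeg_eq, sigNeg_eq_cnt] at h2
  have hcard : Fintype.card (Fin (Module.finrank ℚ (Fin n → ℚ))) = n := by simp
  have hd0 := nonzero_of_cnt d (by rw [hcard]; exact hQ)
  suffices h : ∃ v, QuadraticMap.weightedSumSquares ℚ d v = a by
    obtain ⟨v, hv⟩ := h
    obtain ⟨g⟩ := hd
    exact ⟨g.symm v, by rw [g.symm.map_app, hv]⟩
  simp_rw [wss]
  have hiso : IsoF (fun o : Option (Fin (Module.finrank ℚ (Fin n → ℚ))) => o.elim (-a) d) := by
    have hnz : ∀ o : Option (Fin (Module.finrank ℚ (Fin n → ℚ))), o.elim (-a) d ≠ 0 := by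
      rintro (_ | i)
      · simpa using ha
      · exact hd0 i
    have hc5 : 5 ≤ Fintype.card (Option (Fin (Module.finrank ℚ (Fin n → ℚ)))) := by
      rw [Fintype.card_option, hcard]; omega
    rcases lt_or_gt_of_ne ha with h | h
    · have := h2 h
      obtain ⟨i, -, hi⟩ := Finset.exists_ne_zero_of_sum_ne_zero this.ne'
      have hi' : d i < 0 := by by_contra h'; simp [h'] at hi
      exact meyer _ hnz hc5 none (some i) (by simpa using h) (by simpa using hi')
    · have := h1 h
      obtain ⟨i, -, hi⟩ := Finset.exists_ne_zero_of_sum_ne_zero this.ne'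
      have hi' : 0 < d i := by by_contra h'; simp [h'] at hi
      exact meyer _ hnz hc5 (some i) none (by simpa using hi') (by simpa using h)
  obtain ⟨v, hv, e⟩ := hiso
  rw [Fintype.sum_option] at e
  simp only [Option.elim_none, Option.elim_some] at e
  by_cases h0 : v none = 0
  · have : IsoF d := by
      refine ⟨fun i => v (some i), ?_, ?_⟩
      · intro h'
        apply hv
        funext o
        rcases o with _ | i
        · exact h0
        · exact congrFun h' i
      · rw [h0] at e; linear_combination e
    exact this.represents hd0 a
  · refine ⟨fun i => v (some i) / v none, ?_⟩
    have : ∀ i, d i * (v (some i) / v none) ^ 2 = (d i * v (some i) ^ 2) * (1 / v none ^ 2) := by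
      intro i; field_simp
    simp_rw [this]
    rw [← Finset.sum_mul]
    have e' : ∑ i, d i * v (some i) ^ 2 = a * v none ^ 2 := by linear_combination e
    rw [e']; field_simp

theorem main_diag : ∀ (k : ℕ) (w : Fin k → ℚ) (n : ℕ) (Q : QuadraticForm ℚ (Fin n → ℚ)),
    (∀ i, w i ≠ 0) → n ≤ sigPos Q + sigNeg Q → k + 3 ≤ n →
    cntPos w ≤ sigPos Q → cntNeg w ≤ sigNeg Q →
    ∃ (m : ℕ) (H : QuadraticForm ℚ (Fin m → ℚ)) (e : ((Fin k → ℚ) × (Fin m → ℚ)) ≃ₗ[ℚ] (Fin n → ℚ)),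
      ∀ x y, Q (e (x, y)) = QuadraticMap.weightedSumSquares ℚ w x + H y := by
  intro k
  induction k with
  | zero =>
    intro w n Q _ _ _ _ _
    refine ⟨n, Q, LinearEquiv.uniqueProd, ?_⟩
    intro x y
    simp [wss]
  | succ k ih =>
    intro w n Q hw hQ hk hp hn
    have ep : cntPos w = (if 0 < w 0 then 1 else 0) + cntPos (fun i => w (Fin.succ i)) := by
      simp only [cntPos]; rw [Fin.sum_univ_succ]
    have en : cntNeg w = (if w 0 < 0 then 1 else 0) + cntNeg (fun i => w (Fin.succ i)) := by
      simp only [cntNeg]; rw [Fin.sum_univ_succ]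
    obtain ⟨v, hv⟩ := exists_value Q (by omega) hQ (w 0) (hw 0)
      (fun h => by rw [if_pos h] at ep; omega) (fun h => by rw [if_pos h] at en; omega)
    obtain ⟨m, h, e, hnm, he⟩ := peel Q v (w 0) (hw 0) hv
    subst hnm
    have hequiv : QuadraticMap.Equivalent Q (QuadraticMap.weightedSumSquares ℚ (Fin.cons (w 0) h : Fin (m + 1) → ℚ)) := by
      let g : (ℚ × (Fin m → ℚ)) ≃ₗ[ℚ] (Fin (m + 1) → ℚ) := Fin.consLinearEquiv ℚ (fun _ => ℚ)
      refine ⟨QuadraticMap.IsometryEquiv.symm ⟨g.symm.trans e, ?_⟩⟩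
      intro x
      obtain ⟨⟨t, y⟩, rfl⟩ := g.surjective x
      have h1 : (g.symm.trans e) (g (t, y)) = e (t, y) := by simp
      have h2 : g (t, y) = Fin.cons t y := rfl
      change Q ((g.symm.trans e) (g (t, y))) = _
      rw [h1, he, h2, wss, wss, Fin.sum_univ_succ]
      simp [pow_two]
    have sp := hequiv.sigPos_eq
    have sn := hequiv.sigNeg_eq
    rw [sigPos_eq_cnt] at sp
    rw [sigNeg_eq_cnt] at sn
    have ep' : cntPos (Fin.cons (w 0) h : Fin (m + 1) → ℚ) = (if 0 < w 0 then 1 else 0) + cntPos h := by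
      simp only [cntPos]; rw [Fin.sum_univ_succ]; simp
    have en' : cntNeg (Fin.cons (w 0) h : Fin (m + 1) → ℚ) = (if w 0 < 0 then 1 else 0) + cntNeg h := by
      simp only [cntNeg]; rw [Fin.sum_univ_succ]; simp
    have hone : (if 0 < w 0 then 1 else 0) + (if w 0 < 0 then 1 else 0) ≤ 1 := by
      split_ifs <;> first | omega | linarith
    obtain ⟨m', H, e', he'⟩ := ih (fun i => w (Fin.succ i)) m (QuadraticMap.weightedSumSquares ℚ h)
      (fun i => hw _) (by rw [sigPos_eq_cnt, sigNeg_eq_cnt]; omega) (by omega)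
      (by rw [sigPos_eq_cnt]; omega) (by rw [sigNeg_eq_cnt]; omega)
    let g : (ℚ × (Fin k → ℚ)) ≃ₗ[ℚ] (Fin (k + 1) → ℚ) := Fin.consLinearEquiv ℚ (fun _ => ℚ)
    refine ⟨m', H, (((LinearEquiv.prodCongr g.symm (LinearEquiv.refl ℚ _)).trans (LinearEquiv.prodAssoc ℚ ℚ _ _)).trans
      (LinearEquiv.prodCongr (LinearEquiv.refl ℚ ℚ) e')).trans e, ?_⟩
    intro x y
    obtain ⟨⟨t, x⟩, rfl⟩ := g.surjective x
    have h2 : g (t, x) = Fin.cons t x := rfl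
    simp only [LinearEquiv.trans_apply, LinearEquiv.prodCongr_apply, LinearEquiv.symm_apply_apply, LinearEquiv.prodAssoc_apply, LinearEquiv.refl_apply]
    rw [he, he', h2, wss, wss, Fin.sum_univ_succ]
    simp [pow_two]
    ring

end Paper


namespace Paper

open Matrix

theorem qeval_toQF {n : ℕ} {R : Type*} [CommRing R] (F : Matrix (Fin n) (Fin n) R) (x : Fin n → R) :
    F.toQuadraticForm' x = qeval F x := by
  simp [Matrix.toQuadraticForm', qeval, Matrix.toLinearMap₂'_apply']

theorem qeval_map {n : ℕ} (F : Matrix (Fin n) (Fin n) ℚ) (x : Fin n → ℚ) :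
    qeval (F.map (Rat.cast : ℚ → ℝ)) (fun i => (x i : ℝ)) = ((qeval F x : ℚ) : ℝ) := by
  simp [qeval, dotProduct, mulVec]

theorem cast_real {n : ℕ} (F T : Matrix (Fin n) (Fin n) ℚ) (d : Fin n → ℚ)
    (h : ∀ x, qeval F (T *ᵥ x) = ∑ i, d i * x i ^ 2) (x : Fin n → ℝ) :
    qeval (F.map (Rat.cast : ℚ → ℝ)) ((T.map (Rat.cast : ℚ → ℝ)) *ᵥ x) = ∑ i, (d i : ℝ) * x i ^ 2 := by
  have hden : DenseRange (Pi.map (fun (_ : Fin n) (q : ℚ) => (q : ℝ))) :=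
    DenseRange.piMap (fun _ => Rat.denseRange_cast)
  refine congrFun (DenseRange.equalizer hden (g := fun x => qeval (F.map (Rat.cast : ℚ → ℝ)) ((T.map (Rat.cast : ℚ → ℝ)) *ᵥ x))
    (h := fun x => ∑ i, (d i : ℝ) * x i ^ 2) ?_ ?_ ?_) x
  · simp only [qeval, dotProduct, mulVec]
    fun_prop
  · fun_prop
  · funext x
    have e : (T.map (Rat.cast : ℚ → ℝ)) *ᵥ (fun i => (x i : ℝ)) = fun i => (((T *ᵥ x) i : ℚ) : ℝ) := by
      funext i; simp [mulVec, dotProduct]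
    have := congrArg (Rat.cast : ℚ → ℝ) (h x)
    rw [← qeval_map, ← e] at this
    simp only [Function.comp]
    rw [show (Pi.map (fun (_ : Fin n) (q : ℚ) => (q : ℝ)) x) = fun i => (x i : ℝ) from rfl, this]
    push_cast
    rfl

noncomputable def matEquiv {n : ℕ} {K : Type*} [Field K] (T : Matrix (Fin n) (Fin n) K) (h : T.det ≠ 0) :
    (Fin n → K) ≃ₗ[K] (Fin n → K) :=
  LinearEquiv.ofLinear (Matrix.mulVecLin T) (Matrix.mulVecLin T⁻¹)
    (by rw [← Matrix.mulVecLin_mul, Matrix.mul_nonsing_inv T (isUnit_iff_ne_zero.2 h), Matrix.mulVecLin_one])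
    (by rw [← Matrix.mulVecLin_mul, Matrix.nonsing_inv_mul T (isUnit_iff_ne_zero.2 h), Matrix.mulVecLin_one])

theorem matEquiv_apply {n : ℕ} {K : Type*} [Field K] (T : Matrix (Fin n) (Fin n) K) (h : T.det ≠ 0) (x : Fin n → K) :
    matEquiv T h x = T *ᵥ x := by
  simp [matEquiv]

theorem equiv_diag_real {n : ℕ} (A T : Matrix (Fin n) (Fin n) ℝ) (hT : T.det ≠ 0) (d : Fin n → ℝ)
    (h : ∀ x, qeval A (T *ᵥ x) = ∑ i, d i * x i ^ 2) :
    QuadraticMap.Equivalent A.toQuadraticForm' (QuadraticMap.weightedSumSquares ℝ d) := by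
  refine ⟨QuadraticMap.IsometryEquiv.symm ⟨matEquiv T hT, ?_⟩⟩
  intro x
  change A.toQuadraticForm' (matEquiv T hT x) = _
  rw [matEquiv_apply, qeval_toQF, h]
  simp [QuadraticMap.weightedSumSquares_apply, pow_two]

theorem exists_diag {n : ℕ} (Q : QuadraticForm ℚ (Fin n → ℚ)) :
    ∃ w : Fin n → ℚ, QuadraticMap.Equivalent Q (QuadraticMap.weightedSumSquares ℚ w) := by
  have := QuadraticForm.equivalent_weightedSumSquares Q
  rwa [Module.finrank_fin_fun] at this

theorem det_ne {n : ℕ} (e : (Fin n → ℚ) ≃ₗ[ℚ] (Fin n → ℚ)) :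
    (LinearMap.toMatrix' (e : (Fin n → ℚ) →ₗ[ℚ] (Fin n → ℚ))).det ≠ 0 := by
  rw [LinearMap.det_toMatrix']
  exact e.isUnit_det'.ne_zero

theorem sig_of_hasSignature {n : ℕ} (F : Matrix (Fin n) (Fin n) ℚ) (r s : ℕ) (hF : HasSignature F r s) :
    sigPos F.toQuadraticForm' = r ∧ sigNeg F.toQuadraticForm' = s := by
  classical
  obtain ⟨d, hd⟩ := exists_diag F.toQuadraticForm'
  rw [hd.sigPos_eq, hd.sigNeg_eq, QuadraticForm.sigPos_weightedSumSquares,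
    QuadraticForm.sigNeg_weightedSumSquares]
  obtain ⟨g⟩ := hd
  obtain ⟨hrs, T, hT, h⟩ := hF
  set U := LinearMap.toMatrix' (g.symm.toLinearEquiv : (Fin n → ℚ) →ₗ[ℚ] (Fin n → ℚ)) with hU
  have hU0 : U.det ≠ 0 := det_ne g.symm.toLinearEquiv
  have hUx : ∀ x, qeval F (U *ᵥ x) = ∑ i, d i * x i ^ 2 := by
    intro x
    rw [← wss, ← g.symm.map_app x, qeval_toQF, hU, LinearMap.toMatrix'_mulVec]
    rfl
  have hUr : (U.map (Rat.cast : ℚ → ℝ)).det ≠ 0 := by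
    have : (U.map (Rat.cast : ℚ → ℝ)).det = ((U.det : ℚ) : ℝ) :=
      (RingHom.map_det (Rat.castHom ℝ) U).symm
    rw [this]; exact_mod_cast hU0
  have e1 := equiv_diag_real _ _ hUr (fun i => (d i : ℝ)) (cast_real F U d hUx)
  have e2 := equiv_diag_real _ T hT (fun i => if (i : ℕ) < r then 1 else -1) (by
    intro x
    rw [h]
    refine Finset.sum_congr rfl (fun i _ => ?_)
    split_ifs <;> ring)
  have p1 := QuadraticForm.sigPos_of_equiv_weightedSumSquares e1
  have p2 := QuadraticForm.sigPos_of_equiv_weightedSumSquares e2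
  have n1 := QuadraticForm.sigNeg_of_equiv_weightedSumSquares e1
  have n2 := QuadraticForm.sigNeg_of_equiv_weightedSumSquares e2
  have c1 : {i : Fin n | 0 < (if (i : ℕ) < r then (1 : ℝ) else -1)} = {i : Fin n | (i : ℕ) < r} := by
    ext i; simp only [Set.mem_setOf_eq]; split_ifs with h <;> norm_num [h]
  have c2 : {i : Fin n | (if (i : ℕ) < r then (1 : ℝ) else -1) < 0} = {i : Fin n | (i : ℕ) < r}ᶜ := by
    ext i; simp only [Set.mem_setOf_eq, Set.mem_compl_iff]; split_ifs with h <;> norm_num [h]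
  have c3 : {i : Fin n | (i : ℕ) < r}.ncard = r := by
    rw [Set.ncard_eq_toFinset_card', Set.toFinset_ofPred, Fin.card_filter_val_lt]
    omega
  have c4 := Set.ncard_add_ncard_compl {i : Fin n | (i : ℕ) < r}
  rw [p1, c1, c3] at p2
  rw [n1, c2] at n2
  simp only [Rat.cast_pos, Rat.cast_lt_zero] at p2 n2
  rw [c3, Nat.card_eq_fintype_card, Fintype.card_fin] at c4
  exact ⟨p2, by omega⟩

theorem represents_of_signature_dominance {mf mg : ℕ}
    (F : Matrix (Fin mf) (Fin mf) ℚ) (G : Matrix (Fin mg) (Fin mg) ℚ)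
    (hFsymm : F.IsSymm) (hGsymm : G.IsSymm)
    (hFns : F.det ≠ 0) (hGns : G.det ≠ 0)
    (r s p q : ℕ) (hF : HasSignature F r s) (hG : HasSignature G p q)
    (hrp : p ≤ r) (hsq : q ≤ s) (hrank : mg + 3 ≤ mf) :
    Represents F G := by
  obtain ⟨f1, f2⟩ := sig_of_hasSignature F r s hF
  obtain ⟨g1, g2⟩ := sig_of_hasSignature G p q hG
  have hrs := hF.1
  have hpq := hG.1
  obtain ⟨w, hw⟩ := exists_diag G.toQuadraticForm'
  rw [hw.sigPos_eq, sigPos_eq_cnt] at g1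
  rw [hw.sigNeg_eq, sigNeg_eq_cnt] at g2
  obtain ⟨m, H, e, he⟩ := main_diag mg w mf F.toQuadraticForm'
    (nonzero_of_cnt w (by rw [Fintype.card_fin]; omega)) (by omega) hrank (by omega) (by omega)
  have hm : mf = mg + m := by
    have := e.finrank_eq
    simp at this
    omega
  subst hm
  obtain ⟨g⟩ := hw
  let c : (Fin (mg + m) → ℚ) ≃ₗ[ℚ] ((Fin mg → ℚ) × (Fin m → ℚ)) :=
    (LinearEquiv.funCongrLeft ℚ ℚ finSumFinEquiv).trans (LinearEquiv.sumArrowLequivProdArrow _ _ ℚ ℚ)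
  have hc : ∀ x y, c (Fin.append x y) = (x, y) := by
    intro x y
    ext i
    · simp [c, LinearEquiv.funCongrLeft_apply, LinearMap.funLeft_apply]
    · simp [c, LinearEquiv.funCongrLeft_apply, LinearMap.funLeft_apply]
  let E : (Fin (mg + m) → ℚ) ≃ₗ[ℚ] (Fin (mg + m) → ℚ) :=
    (c.trans (LinearEquiv.prodCongr g.toLinearEquiv (LinearEquiv.refl ℚ _))).trans e
  refine ⟨m, rfl, QuadraticForm.toMatrix' H, LinearMap.toMatrix' (E : (Fin (mg + m) → ℚ) →ₗ[ℚ] _), det_ne E, ?_⟩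
  intro x y
  have hH : qeval (QuadraticForm.toMatrix' H) y = H y := by
    rw [← qeval_toQF]
    simp [Matrix.toQuadraticForm', QuadraticForm.toMatrix']
    exact QuadraticMap.associated_eq_self_apply ℚ H y
  have hE : E (Fin.append x y) = e (g x, y) := by
    simp only [E, LinearEquiv.trans_apply, hc]
    rfl
  rw [LinearMap.toMatrix'_mulVec, hH, ← qeval_toQF, ← qeval_toQF]
  have h0 : (Fin.append x y ∘ Fin.cast rfl) = Fin.append x y := rfl
  rw [h0, LinearEquiv.coe_coe, hE, he, g.map_app]

end Paper
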